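/- arXiv:1704.08228 — 5 statements merged into one kernel-verified Lean document; each statement's English description precedes it below -/
import Mathlib

section
/- Let α > 0 and m ∈ ℝ with m ≤ α. Then there is no density solution to the equation x^m f(x) = (1/Γ(α)) ∫_0^x (x−v)^{α−1} f(v) dv on (0,∞); that is, there is no measurable f : (0,∞) → [0,∞) with ∫_0^∞ f(x) dx = 1 satisfying this equation for every x > 0. -/
open MeasureTheory Real Set Filter

noncomputable section

/-- `f` is a density solution to the integro-differential equation
`I^α_{0+} f = x^m f` on `(0,∞)`: `f` is measurable, nonnegative on `(0,∞)`,
integrates to `1` on `(0,∞)`, and satisfies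
`x^m f(x) = (1/Γ(α)) ∫_0^x (x−v)^{α−1} f(v) dv` for every `x > 0`. -/
def IsDensitySolution (α m : ℝ) (f : ℝ → ℝ) : Prop :=
  Measurable f ∧ (∀ x ∈ Set.Ioi (0:ℝ), 0 ≤ f x) ∧
  (∫ x in Set.Ioi (0:ℝ), f x) = 1 ∧
  ∀ x ∈ Set.Ioi (0:ℝ),
    x ^ m * f x = (1 / Real.Gamma α) * ∫ v in Set.Ioo (0:ℝ) x, (x - v) ^ (α - 1) * f v

/-- The Riemann–Liouville integrand of an integrable function is integrable for almost every
endpoint. -/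
theorem ae_integrableOn_rpow_sub_mul {α : ℝ} (hα : 0 < α) {f : ℝ → ℝ}
    (hf : IntegrableOn f (Ioi 0)) :
    ∀ᵐ x : ℝ, IntegrableOn (fun v => (x - v) ^ (α - 1) * f v) (Ioo 0 x) := by
  have hkernel (n : ℕ) :
      Integrable ((Ioo (0 : ℝ) n).indicator fun t => t ^ (α - 1)) := by
    rw [integrable_indicator_iff measurableSet_Ioo]
    have h := intervalIntegral.intervalIntegrable_rpow' (a := 0) (b := n)
      (show -1 < α - 1 by linarith)
    rw [intervalIntegrable_iff_integrableOn_Ioo_of_le (Nat.cast_nonneg n)] at h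
    exact h
  have hconv (n : ℕ) := (hf.integrable_indicator measurableSet_Ioi).ae_convolution_exists
    (ContinuousLinearMap.mul ℝ ℝ) (hkernel n)
  filter_upwards [ae_all_iff.2 hconv] with x hx
  obtain ⟨n, hn⟩ := exists_nat_gt x
  refine ((hx n).integrableOn (s := Ioo 0 x)).congr_fun (fun v hv => ?_) measurableSet_Ioo
  have hv' : x - v ∈ Ioo (0 : ℝ) n := ⟨by linarith [hv.2], by linarith [hv.1]⟩
  simp only [ContinuousLinearMap.mul_apply', indicator_of_mem (show v ∈ Ioi (0 : ℝ) from hv.1),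
    indicator_of_mem hv', mul_comm]

/-- A function with positive integral on `(0,∞)` has positive integral on some `(0,a)`. -/
theorem exists_setIntegral_Ioo_pos {f : ℝ → ℝ} (hf : IntegrableOn f (Ioi 0))
    (hpos : 0 < ∫ x in Ioi (0 : ℝ), f x) : ∃ a > 0, 0 < ∫ v in Ioo (0 : ℝ) a, f v := by
  have h := intervalIntegral_tendsto_integral_Ioi 0 hf tendsto_id
  obtain ⟨a, ha, ha0⟩ := ((h.eventually_const_lt hpos).and (eventually_gt_atTop 0)).exists
  refine ⟨a, ha0, ?_⟩
  rwa [id, intervalIntegral.integral_of_le ha0.le, integral_Ioc_eq_integral_Ioo] at ha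

/-- On `[x/2, x]` the power `y ^ p` is comparable to `x ^ p` from below. -/
theorem min_mul_rpow_le_rpow (p : ℝ) {x y : ℝ} (hx : 0 < x) (h₁ : x / 2 ≤ y) (h₂ : y ≤ x) :
    min 1 ((1 / 2 : ℝ) ^ p) * x ^ p ≤ y ^ p := by
  have hu : y = y / x * x := by field_simp
  have hlo : 1 / 2 ≤ y / x := by rw [le_div_iff₀ hx]; linarith
  have hhi : y / x ≤ 1 := (div_le_one hx).2 h₂
  rw [hu, mul_rpow (by linarith) hx.le]
  refine mul_le_mul_of_nonneg_right ?_ (rpow_nonneg hx.le p)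
  rcases le_total 0 p with hp | hp
  · exact (min_le_right _ _).trans (rpow_le_rpow (by norm_num) hlo hp)
  · exact (min_le_left _ _).trans
      (one_le_rpow_of_pos_of_le_one_of_nonpos (by linarith) hhi hp)

/-- For `α > 0` and `m ≤ α`, there is no density solution on `(0,∞)`. -/
theorem no_density_solution_of_le (α m : ℝ) (hα : 0 < α) (hm : m ≤ α) :
    ¬ ∃ f : ℝ → ℝ, IsDensitySolution α m f := by
  rintro ⟨f, -, hnonneg, hone, heq⟩
  have hint : IntegrableOn f (Ioi 0) := by
    by_contra h
    rw [integral_undef h] at hone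
    exact zero_ne_one hone
  obtain ⟨a, ha, hmass⟩ := exists_setIntegral_Ioo_pos hint (hone ▸ one_pos)
  set K := ∫ v in Ioo (0 : ℝ) a, f v
  set c := min 1 ((1 / 2 : ℝ) ^ (α - 1))
  have hc : 0 < c := lt_min one_pos (by positivity)
  have hΓ : 0 < 1 / Real.Gamma α := one_div_pos.2 (Gamma_pos_of_pos hα)
  set C := 1 / Real.Gamma α * (c * K)
  have hC : 0 < C := by positivity
  set b := max 1 (2 * a)
  have hbound : ∀ᵐ x ∂volume.restrict (Ioi b), ‖C * x⁻¹‖ ≤ f x := by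
    rw [ae_restrict_iff' measurableSet_Ioi]
    filter_upwards [ae_integrableOn_rpow_sub_mul hα hint] with x hx hxb
    have hx1 : 1 < x := (le_max_left _ _).trans_lt hxb
    have hxa : 2 * a < x := (le_max_right _ _).trans_lt hxb
    have hx0 : 0 < x := one_pos.trans hx1
    have hsub : Ioo 0 a ⊆ Ioo 0 x := Ioo_subset_Ioo_right (by linarith)
    have hlower : c * x ^ (α - 1) * K ≤ ∫ v in Ioo 0 x, (x - v) ^ (α - 1) * f v := by
      calc c * x ^ (α - 1) * K = ∫ v in Ioo 0 a, c * x ^ (α - 1) * f v :=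
            (integral_const_mul _ _).symm
        _ ≤ ∫ v in Ioo 0 a, (x - v) ^ (α - 1) * f v := by
            refine setIntegral_mono_on ((hint.mono_set Ioo_subset_Ioi_self).const_mul _)
              (hx.mono_set hsub) measurableSet_Ioo fun v hv => ?_
            exact mul_le_mul_of_nonneg_right
              (min_mul_rpow_le_rpow _ hx0 (by linarith [hv.2]) (by linarith [hv.1]))
              (hnonneg v hv.1)
        _ ≤ ∫ v in Ioo 0 x, (x - v) ^ (α - 1) * f v := by
            refine setIntegral_mono_set hx ?_ hsub.eventuallyLE
            refine (ae_restrict_iff' measurableSet_Ioo).2 (.of_forall fun v hv => ?_)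
            exact mul_nonneg (rpow_nonneg (by linarith [hv.2]) _) (hnonneg v hv.1)
    have hpow : x ^ m * x⁻¹ ≤ x ^ (α - 1) := by
      rw [← rpow_neg_one, ← rpow_add hx0]
      exact rpow_le_rpow_of_exponent_le hx1.le (by linarith)
    rw [norm_of_nonneg (by positivity)]
    refine le_of_mul_le_mul_left ?_ (rpow_pos_of_pos hx0 m)
    calc x ^ m * (C * x⁻¹) = C * (x ^ m * x⁻¹) := by ring
      _ ≤ C * x ^ (α - 1) := by gcongr
      _ = 1 / Real.Gamma α * (c * x ^ (α - 1) * K) := by ring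
      _ ≤ x ^ m * f x := by rw [heq x hx0]; gcongr
  have hinv : IntegrableOn (fun x => C * x⁻¹) (Ioi b) :=
    (hint.mono_set (Ioi_subset_Ioi (one_pos.le.trans (le_max_left _ _)))).mono'
      (by fun_prop) hbound
  refine not_integrableOn_Ioi_inv (a := b) ?_
  simpa [IntegrableOn, ← mul_assoc, inv_mul_cancel₀ hC.ne'] using hinv.const_mul C⁻¹
end
end

section
/- Let α > 0 and m ∈ ℝ with m > α. Then there exists a density solution to the equation x^m f(x) = (1/Γ(α)) ∫_0^x (x−v)^{α−1} f(v) dv on (0,∞); that is, there exists a measurable f : (0,∞) → [0,∞) with ∫_0^∞ f(x) dx = 1 satisfying this equation for every x > 0. -/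
open MeasureTheory Real Set Filter

noncomputable section

open scoped ENNReal NNReal Topology BoundedContinuousFunction

/-- The bilateral Laplace transform of a measure on the line, with values in `[0, ∞]`. -/
def elaplace (ρ : Measure ℝ) (t : ℝ) : ℝ≥0∞ :=
  ∫⁻ y, ENNReal.ofReal (exp (-(t * y))) ∂ρ

/-- The convolution of `ρ` and `κ`, weighted by `y ↦ exp (-y)`. -/
def tiltedConv (κ ρ : Measure ℝ) : Measure ℝ :=
  (Measure.conv ρ κ).withDensity fun y => ENNReal.ofReal (exp (-y))

lemma lintegral_tiltedConv (κ ρ : Measure ℝ) [SFinite κ] {φ : ℝ → ℝ≥0∞} (hφ : Measurable φ) :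
    ∫⁻ y, φ y ∂tiltedConv κ ρ =
      ∫⁻ y, ∫⁻ z, ENNReal.ofReal (exp (-(y + z))) * φ (y + z) ∂κ ∂ρ := by
  rw [tiltedConv, lintegral_withDensity_eq_lintegral_mul _ (by fun_prop) hφ,
    Measure.lintegral_conv (by fun_prop)]
  rfl

lemma elaplace_tiltedConv (κ ρ : Measure ℝ) [SFinite κ] (t : ℝ) :
    elaplace (tiltedConv κ ρ) t = elaplace κ (t + 1) * elaplace ρ (t + 1) := by
  unfold elaplace
  rw [lintegral_tiltedConv κ ρ (by fun_prop), ← lintegral_const_mul _ (by fun_prop)]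
  refine lintegral_congr fun y => ?_
  rw [← lintegral_mul_const _ (by fun_prop)]
  refine lintegral_congr fun z => ?_
  rw [← ENNReal.ofReal_mul (exp_nonneg _), ← ENNReal.ofReal_mul (exp_nonneg _), ← exp_add,
    ← exp_add]
  ring_nf

lemma elaplace_iterate_tiltedConv (κ ρ : Measure ℝ) [SFinite κ] (n : ℕ) (t : ℝ) :
    elaplace ((tiltedConv κ)^[n] ρ) t =
      (∏ k ∈ Finset.range n, elaplace κ (t + k + 1)) * elaplace ρ (t + n) := by
  induction n generalizing t with
  | zero => simp
  | succ n ih =>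
    rw [Function.iterate_succ_apply', elaplace_tiltedConv, ih, Finset.prod_range_succ']
    push_cast
    simp only [add_zero, add_assoc, add_comm (1 : ℝ)]
    ring

lemma elaplace_dirac (a t : ℝ) :
    elaplace (Measure.dirac a) t = ENNReal.ofReal (exp (-(t * a))) :=
  lintegral_dirac' _ (by fun_prop)

lemma elaplace_zero (ρ : Measure ℝ) : elaplace ρ 0 = ρ univ := by
  simp [elaplace]

lemma elaplace_pos {κ : Measure ℝ} (hκ : κ ≠ 0) (t : ℝ) : 0 < elaplace κ t := by
  rw [elaplace, lintegral_pos_iff_support (by fun_prop)]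
  have : (Function.support fun y => ENNReal.ofReal (exp (-(t * y)))) = univ := by
    ext y
    simp [exp_pos]
  rw [this]
  exact Measure.measure_univ_pos.2 hκ

lemma elaplace_le_measure_univ {κ : Measure ℝ} (hκ : κ (Iic 0) = 0) {t : ℝ} (ht : 0 ≤ t) :
    elaplace κ t ≤ κ univ := by
  rw [elaplace, ← lintegral_one]
  refine lintegral_mono_ae ?_
  have : ∀ᵐ y ∂κ, y ∉ Iic (0 : ℝ) := measure_eq_zero_iff_ae_notMem.1 hκ
  filter_upwards [this] with y hy
  rw [← ENNReal.ofReal_one]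
  refine ENNReal.ofReal_le_ofReal (exp_le_one_iff.2 ?_)
  have : 0 < y := not_le.1 hy
  have := mul_nonneg ht this.le
  linarith

lemma tendsto_elaplace_natCast {κ : Measure ℝ} [IsFiniteMeasure κ] (hκ : κ (Iic 0) = 0) :
    Tendsto (fun n : ℕ => elaplace κ n) atTop (𝓝 0) := by
  have hpos : ∀ᵐ y ∂κ, y ∉ Iic (0 : ℝ) := measure_eq_zero_iff_ae_notMem.1 hκ
  have := tendsto_lintegral_of_dominated_convergence (μ := κ)
    (F := fun (n : ℕ) y => ENNReal.ofReal (exp (-(n * y)))) (f := fun _ => 0) (fun _ => 1)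
    (fun n => by fun_prop) ?_ (by simp) ?_
  · simpa [elaplace] using this
  · intro n
    filter_upwards [hpos] with y hy
    rw [← ENNReal.ofReal_one]
    refine ENNReal.ofReal_le_ofReal (exp_le_one_iff.2 ?_)
    have : 0 < y := not_le.1 hy
    have : 0 ≤ n * y := by positivity
    linarith
  · filter_upwards [hpos] with y hy
    have hy : 0 < y := not_le.1 hy
    rw [← ENNReal.ofReal_zero]
    refine ENNReal.tendsto_ofReal (tendsto_exp_neg_atTop_nhds_zero.comp ?_)
    exact tendsto_natCast_atTop_atTop.atTop_mul_const hy

lemma tsum_prod_range_ne_top {c : ℕ → ℝ≥0∞} (hc : ∀ k, c k ≠ ∞)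
    (h : Tendsto c atTop (𝓝 0)) : ∑' n, ∏ k ∈ Finset.range n, c k ≠ ∞ := by
  lift c to ℕ → ℝ≥0 using hc
  simp only [← ENNReal.ofNNReal_finsetProd]
  rw [ENNReal.tsum_coe_ne_top_iff_summable, ← NNReal.summable_coe]
  refine summable_of_ratio_norm_eventually_le (r := 1 / 2) (by norm_num) ?_
  have h' : Tendsto c atTop (𝓝 0) := ENNReal.tendsto_coe.1 (by simpa using h)
  filter_upwards [h'.eventually (gt_mem_nhds (show (0 : ℝ≥0) < 1 / 2 by norm_num))] with n hn
  rw [Finset.prod_range_succ, mul_comm, NNReal.coe_mul, norm_mul]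
  gcongr
  have : (c n : ℝ) ≤ ((1 / 2 : ℝ≥0) : ℝ) := by exact_mod_cast hn.le
  simpa using this

/-- The fixed point equation `ρ = tiltedConv κ ρ`, perturbed by a small point mass at `a`, has a
solution among the probability measures. -/
lemma exists_perturbed_fixed_point (κ : Measure ℝ) [IsFiniteMeasure κ] (hκ : κ (Iic 0) = 0)
    (a : ℝ) : ∃ ρ : ProbabilityMeasure ℝ, ∃ c : ℝ≥0∞, c ≤ 1 ∧
      (ρ : Measure ℝ) = c • Measure.dirac a + tiltedConv κ ρ := by
  let σ : ℕ → Measure ℝ := fun n => (tiltedConv κ)^[n] (Measure.dirac a)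
  let τ : Measure ℝ := Measure.sum σ
  have hσ (n : ℕ) : σ n univ =
      ∏ k ∈ Finset.range n, elaplace κ ((k + 1 : ℕ) : ℝ) * ENNReal.ofReal (exp (-a)) := by
    rw [← elaplace_zero, elaplace_iterate_tiltedConv, elaplace_dirac, Finset.prod_mul_distrib,
      Finset.prod_const, Finset.card_range, ← ENNReal.ofReal_pow (exp_nonneg _), ← exp_nat_mul]
    simp
  have hτ_top : τ univ ≠ ∞ := by
    rw [Measure.sum_apply _ MeasurableSet.univ]
    simp only [hσ]
    refine tsum_prod_range_ne_top (fun k => ENNReal.mul_ne_top ?_ ENNReal.ofReal_ne_top) ?_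
    · exact ne_top_of_le_ne_top (measure_ne_top κ univ) (elaplace_le_measure_univ hκ (by positivity))
    · have := ((tendsto_elaplace_natCast hκ).comp (tendsto_add_atTop_nat 1))
      simpa using ENNReal.Tendsto.mul_const this (Or.inr ENNReal.ofReal_ne_top)
  have hτ : τ = Measure.dirac a + tiltedConv κ τ := by
    refine Measure.ext_of_lintegral _ fun φ hφ => ?_
    rw [lintegral_add_measure, lintegral_tiltedConv κ τ hφ, lintegral_sum_measure,
      lintegral_sum_measure, tsum_eq_zero_add' ENNReal.summable]
    congr 1
    refine tsum_congr fun n => ?_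
    rw [← lintegral_tiltedConv κ _ hφ]
    simp only [σ, Function.iterate_succ_apply']
  have hτ_one : 1 ≤ τ univ := by
    rw [hτ]
    simp
  have hτ_zero : τ univ ≠ 0 := (zero_lt_one.trans_le hτ_one).ne'
  refine ⟨⟨(τ univ)⁻¹ • τ, ⟨by simp [ENNReal.inv_mul_cancel hτ_zero hτ_top]⟩⟩, (τ univ)⁻¹,
    ENNReal.inv_le_one.2 hτ_one, ?_⟩
  refine Measure.ext_of_lintegral _ fun φ hφ => ?_
  simp only [ProbabilityMeasure.coe_mk]
  rw [lintegral_add_measure, lintegral_tiltedConv κ _ hφ]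
  simp only [lintegral_smul_measure]
  rw [← lintegral_tiltedConv κ _ hφ, ← smul_add, ← lintegral_add_measure, ← hτ]

lemma isTightMeasureSet_of_elaplace_le {S : Set (Measure ℝ)} {M : ℝ≥0∞} (hM : M ≠ ∞)
    (h : ∀ ρ ∈ S, elaplace ρ 1 ≤ M ∧ elaplace ρ (-1) ≤ M) : IsTightMeasureSet S := by
  rw [isTightMeasureSet_iff_exists_isCompact_measure_compl_le]
  intro ε hε
  have hlim : Tendsto (fun r : ℝ => ENNReal.ofReal (exp (-r)) * (M + M)) atTop (𝓝 0) := by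
    have := ENNReal.tendsto_ofReal tendsto_exp_neg_atTop_nhds_zero
    simpa using ENNReal.Tendsto.mul_const (b := M + M) this (Or.inr (by simp [hM]))
  obtain ⟨r, hr⟩ := (hlim.eventually (ge_mem_nhds hε)).exists
  refine ⟨Metric.closedBall 0 r, isCompact_closedBall 0 r, fun ρ hρ => le_trans ?_ hr⟩
  have hsum : ∫⁻ y, (ENNReal.ofReal (exp (-(1 * y))) + ENNReal.ofReal (exp (-(-1 * y)))) ∂ρ
      ≤ M + M := by
    rw [lintegral_add_left (by fun_prop)]
    exact add_le_add (h ρ hρ).1 (h ρ hρ).2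
  have hmarkov := mul_meas_ge_le_lintegral (μ := ρ)
    (f := fun y => ENNReal.ofReal (exp (-(1 * y))) + ENNReal.ofReal (exp (-(-1 * y))))
    (by fun_prop) (ENNReal.ofReal (exp r))
  have hsub : (Metric.closedBall (0 : ℝ) r)ᶜ ⊆ {y | ENNReal.ofReal (exp r) ≤
      ENNReal.ofReal (exp (-(1 * y))) + ENNReal.ofReal (exp (-(-1 * y)))} := by
    intro y hy
    have hy : r < |y| := by simpa using hy
    change ENNReal.ofReal (exp r) ≤ _ + _
    rcases lt_abs.1 hy with hy | hy
    · exact le_add_left (ENNReal.ofReal_le_ofReal (exp_le_exp.2 (by linarith)))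
    · exact le_add_right (ENNReal.ofReal_le_ofReal (exp_le_exp.2 (by linarith)))
  calc ρ (Metric.closedBall 0 r)ᶜ
      = ENNReal.ofReal (exp (-r)) * (ENNReal.ofReal (exp r) * ρ (Metric.closedBall 0 r)ᶜ) := by
        rw [← mul_assoc, ← ENNReal.ofReal_mul (exp_nonneg _), ← exp_add]
        simp
    _ ≤ ENNReal.ofReal (exp (-r)) * (M + M) := by
        gcongr
        exact (mul_le_mul_right (measure_mono hsub) _).trans (hmarkov.trans hsum)

lemma tendsto_lintegral_conv {ι : Type*} {F : Filter ι} {ρs : ι → ProbabilityMeasure ℝ}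
    {ρ : ProbabilityMeasure ℝ} (h : Tendsto ρs F (𝓝 ρ)) (κ : Measure ℝ) [IsFiniteMeasure κ]
    (ψ : ℝ →ᵇ ℝ≥0) :
    Tendsto (fun i => ∫⁻ y, ψ y ∂Measure.conv (ρs i : Measure ℝ) κ) F
      (𝓝 (∫⁻ y, ψ y ∂Measure.conv (ρ : Measure ℝ) κ)) := by
  rcases eq_or_ne κ 0 with rfl | hκ
  · simpa using tendsto_const_nhds
  have hκ₀ : κ univ ≠ 0 := (Measure.measure_univ_pos.2 hκ).ne'
  have hκ_top : κ univ ≠ ∞ := measure_ne_top κ univ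
  let κ₁ : ProbabilityMeasure ℝ :=
    ⟨(κ univ)⁻¹ • κ, ⟨by simp [ENNReal.inv_mul_cancel hκ₀ hκ_top]⟩⟩
  have hκ₁ : κ = κ univ • (κ₁ : Measure ℝ) := by
    simp only [κ₁, ProbabilityMeasure.coe_mk]
    rw [smul_smul, ENNReal.mul_inv_cancel hκ₀ hκ_top, one_smul]
  have key (σ : ProbabilityMeasure ℝ) : ∫⁻ y, ψ y ∂Measure.conv (σ : Measure ℝ) κ =
      κ univ * ∫⁻ p, ψ.compContinuous ⟨fun p : ℝ × ℝ => p.1 + p.2, continuous_add⟩ p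
        ∂(σ.prod κ₁ : Measure (ℝ × ℝ)) := by
    have hψ : Measurable fun y => (ψ y : ℝ≥0∞) := by fun_prop
    rw [Measure.lintegral_conv hψ, ProbabilityMeasure.toMeasure_prod,
      lintegral_prod _ (by fun_prop), ← lintegral_const_mul' _ _ hκ_top]
    refine lintegral_congr fun y => ?_
    nth_rw 1 [hκ₁]
    rw [lintegral_smul_measure]
    rfl
  simp only [key]
  refine ENNReal.Tendsto.const_mul ?_ (Or.inr hκ_top)
  have hprod : Tendsto (fun i => (ρs i).prod κ₁) F (𝓝 (ρ.prod κ₁)) :=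
    (ProbabilityMeasure.continuous_prod.tendsto (ρ, κ₁)).comp (h.prodMk_nhds tendsto_const_nhds)
  exact ProbabilityMeasure.tendsto_iff_forall_lintegral_tendsto.1 hprod _

/-- A continuous function with values in `[0, 1]`, as a bounded continuous function. -/
def sigmoidNNReal : ℝ →ᵇ ℝ≥0 :=
  BoundedContinuousFunction.mkOfBound
    ⟨fun y => (sigmoid y).toNNReal, continuous_real_toNNReal.comp continuous_sigmoid⟩ 1 fun x y => by
      simp only [ContinuousMap.coe_mk, NNReal.dist_eq, coe_toNNReal _ (sigmoid_nonneg _)]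
      rw [abs_le]
      constructor <;> linarith [sigmoid_nonneg x, sigmoid_nonneg y, sigmoid_le_one x,
        sigmoid_le_one y]

lemma coe_sigmoidNNReal (y : ℝ) : (sigmoidNNReal y : ℝ≥0∞) = ENNReal.ofReal (sigmoid y) := rfl

lemma ofReal_exp_mul_sigmoid_neg (y : ℝ) :
    ENNReal.ofReal (exp y) * ENNReal.ofReal (sigmoid (-y)) = ENNReal.ofReal (sigmoid y) := by
  rw [← ENNReal.ofReal_mul (exp_nonneg _)]
  have := sigmoid_mul_rexp_neg (-y)
  rw [neg_neg] at this
  rw [← this, mul_comm]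

lemma eq_tiltedConv_of_forall_lintegral_eq {κ ρ : Measure ℝ} [SFinite κ] [IsFiniteMeasure ρ]
    (h : ∀ f : ℝ →ᵇ ℝ≥0, ∫⁻ y, f y * ENNReal.ofReal (sigmoid y) ∂ρ =
      ∫⁻ y, f y * ENNReal.ofReal (sigmoid (-y)) ∂Measure.conv ρ κ) :
    ρ = tiltedConv κ ρ := by
  have hs : Measurable fun y => ENNReal.ofReal (sigmoid y) :=
    (continuous_sigmoid.measurable).ennreal_ofReal
  have hs' : Measurable fun y => ENNReal.ofReal (sigmoid (-y)) := hs.comp measurable_neg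
  have hfin : IsFiniteMeasure (ρ.withDensity fun y => ENNReal.ofReal (sigmoid y)) := by
    refine isFiniteMeasure_withDensity (ne_top_of_le_ne_top (measure_ne_top ρ univ) ?_)
    rw [← lintegral_one]
    refine lintegral_mono fun y => ?_
    simpa using sigmoid_le_one y
  have hext : ρ.withDensity (fun y => ENNReal.ofReal (sigmoid y)) =
      (Measure.conv ρ κ).withDensity fun y => ENNReal.ofReal (sigmoid (-y)) := by
    refine ext_of_forall_lintegral_eq_of_IsFiniteMeasure fun f => ?_
    have hf : Measurable fun y => (f y : ℝ≥0∞) := by fun_prop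
    rw [lintegral_withDensity_eq_lintegral_mul _ hs hf,
      lintegral_withDensity_eq_lintegral_mul _ hs' hf]
    simpa only [Pi.mul_apply, mul_comm] using h f
  refine Measure.ext_of_lintegral _ fun φ hφ => ?_
  have hcancel (y : ℝ) : ENNReal.ofReal (sigmoid y) * (ENNReal.ofReal (sigmoid y))⁻¹ = 1 :=
    ENNReal.mul_inv_cancel (by simpa using sigmoid_pos y) ENNReal.ofReal_ne_top
  have hratio (y : ℝ) : ENNReal.ofReal (sigmoid (-y)) * (ENNReal.ofReal (sigmoid y))⁻¹ =
      ENNReal.ofReal (exp (-y)) := by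
    have := ofReal_exp_mul_sigmoid_neg (-y)
    rw [neg_neg] at this
    rw [← this, mul_assoc, hcancel, mul_one]
  calc ∫⁻ y, φ y ∂ρ
      = ∫⁻ y, (ENNReal.ofReal (sigmoid y))⁻¹ * φ y
          ∂ρ.withDensity (fun y => ENNReal.ofReal (sigmoid y)) := by
        rw [lintegral_withDensity_eq_lintegral_mul _ hs (by fun_prop)]
        refine lintegral_congr fun y => ?_
        rw [Pi.mul_apply, ← mul_assoc, hcancel, one_mul]
    _ = ∫⁻ y, φ y ∂tiltedConv κ ρ := by
        rw [hext, lintegral_withDensity_eq_lintegral_mul _ hs' (by fun_prop), tiltedConv,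
          lintegral_withDensity_eq_lintegral_mul _ (by fun_prop) hφ]
        refine lintegral_congr fun y => ?_
        rw [Pi.mul_apply, Pi.mul_apply, ← mul_assoc, hratio]

/-- If `κ` is a nonzero finite measure on `(0, ∞)`, then `tiltedConv κ` fixes some probability
measure. -/
theorem exists_eq_tiltedConv {κ : Measure ℝ} [IsFiniteMeasure κ] (hκ : κ (Iic 0) = 0)
    (hκ₀ : κ ≠ 0) : ∃ ρ : ProbabilityMeasure ℝ, (ρ : Measure ℝ) = tiltedConv κ ρ := by
  choose ρs c hc hρs using fun n : ℕ => exists_perturbed_fixed_point κ hκ (-n : ℝ)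
  let M : ℝ≥0∞ := max (elaplace κ 1)⁻¹ (1 + κ univ)
  have hM : M ≠ ∞ := by
    simp [M, (elaplace_pos hκ₀ 1).ne']
  have hL (n : ℕ) (t : ℝ) : elaplace (ρs n : Measure ℝ) t =
      c n * ENNReal.ofReal (exp (t * n)) +
        elaplace κ (t + 1) * elaplace (ρs n : Measure ℝ) (t + 1) := by
    rw [← elaplace_tiltedConv]
    nth_rw 1 [hρs n]
    rw [elaplace, lintegral_add_measure, lintegral_smul_measure]
    change c n * elaplace _ _ + elaplace _ _ = _
    rw [elaplace_dirac]
    simp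
  have htight : IsTightMeasureSet {((σ : ProbabilityMeasure ℝ) : Measure ℝ) | σ ∈ range ρs} := by
    refine isTightMeasureSet_of_elaplace_le hM ?_
    rintro _ ⟨_, ⟨n, rfl⟩, rfl⟩
    constructor
    · refine le_max_of_le_left ?_
      have := hL n 0
      rw [elaplace_zero, measure_univ, zero_add] at this
      rw [ENNReal.le_inv_iff_mul_le, mul_comm]
      exact le_add_self.trans this.ge
    · refine le_max_of_le_right ?_
      rw [hL, neg_add_cancel, elaplace_zero, elaplace_zero, measure_univ (μ := (ρs n : Measure ℝ)), mul_one]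
      gcongr
      refine (mul_le_mul' (hc n) (ENNReal.ofReal_le_ofReal (exp_le_one_iff.2 ?_))).trans (by simp)
      simp
  obtain ⟨ρ, -, hρ⟩ := (isCompact_closure_of_isTightMeasureSet htight).exists_mapClusterPt
    (f := atTop) (u := ρs) (by
      rw [le_principal_iff]
      exact mem_map.2 (univ_mem' fun n => subset_closure (mem_range_self n)))
  obtain ⟨U, hU, hlim⟩ := mapClusterPt_iff_ultrafilter.1 hρ
  refine ⟨ρ, eq_tiltedConv_of_forall_lintegral_eq fun f => ?_⟩
  have hleft := ProbabilityMeasure.tendsto_iff_forall_lintegral_tendsto.1 hlim (f * sigmoidNNReal)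
  have hright := tendsto_lintegral_conv hlim κ
    (f * sigmoidNNReal.compContinuous ⟨fun y => -y, continuous_neg⟩)
  have hs : Measurable fun y => ENNReal.ofReal (sigmoid y) :=
    (continuous_sigmoid.measurable).ennreal_ofReal
  have hf : Measurable fun y => (f y : ℝ≥0∞) := by fun_prop
  have heq (n : ℕ) : ∫⁻ y, (f * sigmoidNNReal) y ∂(ρs n : Measure ℝ) =
      c n * (f (-n : ℝ) * ENNReal.ofReal (sigmoid (-n))) +
        ∫⁻ y, (f * sigmoidNNReal.compContinuous ⟨fun y => -y, continuous_neg⟩) y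
          ∂Measure.conv (ρs n : Measure ℝ) κ := by
    have hg : Measurable fun y => ((f * sigmoidNNReal) y : ℝ≥0∞) := by fun_prop
    conv_lhs => rw [hρs n]
    rw [lintegral_add_measure, lintegral_smul_measure, lintegral_dirac' _ hg, tiltedConv,
      lintegral_withDensity_eq_lintegral_mul _ (by fun_prop) hg]
    congr 1
    refine lintegral_congr fun y => ?_
    have := ofReal_exp_mul_sigmoid_neg (-y)
    rw [neg_neg] at this
    simp only [Pi.mul_apply, BoundedContinuousFunction.coe_mul, ENNReal.coe_mul,
      coe_sigmoidNNReal, BoundedContinuousFunction.compContinuous_apply, ContinuousMap.coe_mk]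
    rw [← this]
    ring
  have hzero : Tendsto (fun n : ℕ => c n * (f (-n : ℝ) * ENNReal.ofReal (sigmoid (-n)))) atTop
      (𝓝 0) := by
    have hsig : Tendsto (fun n : ℕ => ENNReal.ofReal (sigmoid (-n))) atTop (𝓝 0) := by
      rw [← ENNReal.ofReal_zero]
      exact ENNReal.tendsto_ofReal (tendsto_sigmoid_atBot.comp
        (tendsto_neg_atTop_atBot.comp tendsto_natCast_atTop_atTop))
    have hbound : Tendsto (fun n : ℕ => 1 * ((nndist f 0 : ℝ≥0∞) * ENNReal.ofReal (sigmoid (-n))))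
        atTop (𝓝 0) := by
      simpa using ENNReal.Tendsto.const_mul (a := (nndist f 0 : ℝ≥0∞)) hsig (Or.inr (by simp))
    refine tendsto_of_tendsto_of_tendsto_of_le_of_le tendsto_const_nhds hbound (fun _ => zero_le)
      fun n => ?_
    exact mul_le_mul' (hc n) (mul_le_mul_left
      (ENNReal.coe_le_coe.2 (BoundedContinuousFunction.NNReal.upper_bound f _)) _)
  simp only [heq] at hleft
  have := tendsto_nhds_unique hleft ((hzero.mono_left hU).add hright)
  rw [zero_add] at this
  simpa [coe_sigmoidNNReal] using this

/-- The law of `-d log U`, where `U` has density `u ^ (d - 1) * (1 - u) ^ (α - 1) / Γ(α)` on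
`(0, 1)`. -/
def logBetaMeasure (d α : ℝ) : Measure ℝ :=
  ENNReal.ofReal (ProbabilityTheory.beta d α / Gamma α) •
    (ProbabilityTheory.betaMeasure d α).map fun u => -(d * log u)

lemma lintegral_logBetaMeasure {d α : ℝ} (hd : 0 < d) (hα : 0 < α) {φ : ℝ → ℝ≥0∞}
    (hφ : Measurable φ) :
    ∫⁻ z, φ z ∂logBetaMeasure d α = ∫⁻ u in Ioo 0 1,
      ENNReal.ofReal (u ^ (d - 1) * (1 - u) ^ (α - 1) / Gamma α) * φ (-(d * log u)) := by
  have hpdf : Measurable (ProbabilityTheory.betaPDF d α) :=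
    (ProbabilityTheory.measurable_betaPDFReal d α).ennreal_ofReal
  have hβ := ProbabilityTheory.beta_pos hd hα
  have hΓ := Gamma_pos_of_pos hα
  rw [logBetaMeasure, lintegral_smul_measure, lintegral_map hφ (by fun_prop),
    ProbabilityTheory.betaMeasure, lintegral_withDensity_eq_lintegral_mul _ hpdf (by fun_prop),
    smul_eq_mul, ← lintegral_const_mul _ (by fun_prop), ← lintegral_indicator measurableSet_Ioo]
  refine lintegral_congr fun u => ?_
  rw [Pi.mul_apply]
  by_cases hu : u ∈ Ioo (0 : ℝ) 1
  · rw [indicator_of_mem hu, ProbabilityTheory.betaPDF_of_pos_lt_one hu.1 hu.2, ← mul_assoc,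
      ← ENNReal.ofReal_mul (by positivity)]
    congr 2
    field_simp
  · rw [indicator_of_notMem hu, ProbabilityTheory.betaPDF_eq, if_neg (show ¬(0 < u ∧ u < 1) from hu)]
    simp

lemma isFiniteMeasure_logBetaMeasure {d α : ℝ} (hd : 0 < d) (hα : 0 < α) :
    IsFiniteMeasure (logBetaMeasure d α) := by
  have := ProbabilityTheory.isProbabilityMeasureBeta hd hα
  exact Measure.smul_finite _ ENNReal.ofReal_ne_top

lemma logBetaMeasure_ne_zero {d α : ℝ} (hd : 0 < d) (hα : 0 < α) : logBetaMeasure d α ≠ 0 := by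
  have := ProbabilityTheory.isProbabilityMeasureBeta hd hα
  have hpos := div_pos (ProbabilityTheory.beta_pos hd hα) (Gamma_pos_of_pos hα)
  rw [← Measure.measure_univ_ne_zero, logBetaMeasure, Measure.smul_apply,
    Measure.map_apply (by fun_prop) MeasurableSet.univ]
  simpa using hpos

lemma logBetaMeasure_Iic_zero {d α : ℝ} (hd : 0 < d) (hα : 0 < α) :
    logBetaMeasure d α (Iic 0) = 0 := by
  rw [← lintegral_indicator_one measurableSet_Iic, lintegral_logBetaMeasure hd hα
    (measurable_one.indicator measurableSet_Iic)]
  refine (setLIntegral_congr_fun measurableSet_Ioo fun u hu => ?_).trans lintegral_zero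
  have : 0 < -(d * log u) := by
    have := mul_pos_of_neg_of_neg (neg_neg_of_pos hd) (log_neg hu.1 hu.2)
    linarith
  simp [indicator_of_notMem (show -(d * log u) ∉ Iic (0 : ℝ) from not_le.2 this)]

/-- The kernel `x ^ (-m) * (x - v) ^ (α - 1) / Γ(α)` of the operator `x ^ (-m) I^α_{0+}`. -/
def fracKernel (α m v x : ℝ) : ℝ :=
  x ^ (-m) * (x - v) ^ (α - 1) / Gamma α

lemma setLIntegral_Ioo_comp_div (α m : ℝ) {v : ℝ} (hv : 0 < v) (φ : ℝ → ℝ≥0∞) :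
    ∫⁻ u in Ioo 0 1,
      ENNReal.ofReal (u ^ (m - α - 1) * (1 - u) ^ (α - 1) / Gamma α) * φ (v / u) =
    ∫⁻ x in Ioi v, ENNReal.ofReal (v ^ (m - α)) * (ENNReal.ofReal (fracKernel α m v x) * φ x) := by
  have himage : (fun x => v / x) '' Ioi v = Ioo 0 1 := by
    ext u
    constructor
    · rintro ⟨x, hx, rfl⟩
      have hx0 : 0 < x := hv.trans hx
      exact ⟨div_pos hv hx0, (div_lt_one hx0).2 hx⟩
    · rintro ⟨hu0, hu1⟩
      exact ⟨v / u, (lt_div_iff₀ hu0).2 (by nlinarith), by field_simp⟩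
  rw [← himage, lintegral_image_eq_lintegral_abs_deriv_mul (f := fun x => v / x)
    (f' := fun x => -v / x ^ 2) measurableSet_Ioi]
  · refine setLIntegral_congr_fun measurableSet_Ioi fun x hx => ?_
    have hvx : v < x := hx
    have hx0 : 0 < x := hv.trans hvx
    have hxv : 0 < x - v := sub_pos.2 hvx
    rw [← mul_assoc, ← mul_assoc, ← ENNReal.ofReal_mul (abs_nonneg _),
      ← ENNReal.ofReal_mul (by positivity), div_div_cancel₀ hv.ne']
    congr 2
    have h1 : 1 - v / x = (x - v) / x := by field_simp
    have h2 : |(-v / x ^ 2)| = v / x ^ 2 := by rw [neg_div, abs_neg, abs_of_pos (by positivity)]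
    have h3 : x ^ (-m) = x ^ (-(2 : ℝ)) * x ^ (-(m - α - 1)) * x ^ (-(α - 1)) := by
      rw [← rpow_add hx0, ← rpow_add hx0]
      ring_nf
    have h4 : v ^ (m - α) = v * v ^ (m - α - 1) := by
      rw [rpow_sub_one hv.ne']
      field_simp
    rw [fracKernel, h1, h2, h3, h4, div_rpow hv.le hx0.le, div_rpow hxv.le hx0.le, rpow_neg hx0.le,
      rpow_neg hx0.le, rpow_neg hx0.le, rpow_two]
    field_simp
  · intro x hx
    have hx0 : x ≠ 0 := (hv.trans hx).ne'
    have := (hasDerivAt_inv hx0).const_mul v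
    simp only [← div_eq_mul_inv] at this
    refine (this.congr_deriv ?_).hasDerivWithinAt
    field_simp
  · intro x hx y hy hxy
    have hx0 : x ≠ 0 := (hv.trans hx).ne'
    have hy0 : y ≠ 0 := (hv.trans hy).ne'
    have hxy : v / x = v / y := hxy
    rw [div_eq_div_iff hx0 hy0] at hxy
    exact (mul_left_cancel₀ hv.ne' hxy).symm

/-- There is a nonzero finite measure on `(0, ∞)` fixed by the operator `x ^ (-m) I^α_{0+}`,
acting on measures. -/
lemma exists_fixed_measure {α m : ℝ} (hα : 0 < α) (hm : α < m) :
    ∃ μ : Measure ℝ, IsFiniteMeasure μ ∧ μ ≠ 0 ∧ μ (Iic 0) = 0 ∧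
      ∀ φ : ℝ → ℝ≥0∞, Measurable φ → ∫⁻ x, φ x ∂μ =
        ∫⁻ v, (∫⁻ x in Ioi v, ENNReal.ofReal (fracKernel α m v x) * φ x) ∂μ := by
  set d := m - α with hd_def
  have hd : 0 < d := sub_pos.2 hm
  have := isFiniteMeasure_logBetaMeasure hd hα
  obtain ⟨ρ, hρ⟩ := exists_eq_tiltedConv (logBetaMeasure_Iic_zero hd hα)
    (logBetaMeasure_ne_zero hd hα)
  let μ : Measure ℝ :=
    ((ρ : Measure ℝ).withDensity fun y => ENNReal.ofReal (exp y)).map fun y => exp (y / d)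
  have hμ (φ : ℝ → ℝ≥0∞) (hφ : Measurable φ) :
      ∫⁻ x, φ x ∂μ = ∫⁻ y, ENNReal.ofReal (exp y) * φ (exp (y / d)) ∂(ρ : Measure ℝ) := by
    rw [lintegral_map hφ (by fun_prop),
      lintegral_withDensity_eq_lintegral_mul _ (by fun_prop) (by fun_prop)]
    rfl
  have hκ (φ : ℝ → ℝ≥0∞) (hφ : Measurable φ) : ∫⁻ x, φ x ∂μ =
      ∫⁻ y, ∫⁻ z, φ (exp ((y + z) / d)) ∂logBetaMeasure d α ∂(ρ : Measure ℝ) := by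
    rw [hμ φ hφ]
    nth_rw 1 [hρ]
    rw [lintegral_tiltedConv _ _ (by fun_prop)]
    refine lintegral_congr fun y => lintegral_congr fun z => ?_
    rw [← mul_assoc, ← ENNReal.ofReal_mul (exp_nonneg _), ← exp_add]
    simp
  have huniv : μ univ = logBetaMeasure d α univ := by
    rw [← lintegral_one, hκ _ measurable_const]
    simp
  refine ⟨μ, ⟨?_⟩, ?_, ?_, fun φ hφ => ?_⟩
  · rw [huniv]
    exact measure_lt_top _ _
  · rw [← Measure.measure_univ_ne_zero, huniv, Measure.measure_univ_ne_zero]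
    exact logBetaMeasure_ne_zero hd hα
  · rw [Measure.map_apply (by fun_prop) measurableSet_Iic]
    have : (fun y => exp (y / d)) ⁻¹' Iic 0 = ∅ := by
      ext y
      simp [exp_pos]
    rw [this, measure_empty]
  · have hmeas : Measurable fun v =>
        ∫⁻ x in Ioi v, ENNReal.ofReal (fracKernel α m v x) * φ x := by
      have hk : Measurable fun p : ℝ × ℝ => (Ioi p.1).indicator
          (fun x => ENNReal.ofReal (fracKernel α m p.1 x) * φ x) p.2 := by
        have hset : MeasurableSet {p : ℝ × ℝ | p.1 < p.2} :=
          measurableSet_lt measurable_fst measurable_snd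
        have hf : Measurable fun p : ℝ × ℝ =>
            ENNReal.ofReal (fracKernel α m p.1 p.2) * φ p.2 := by
          unfold fracKernel
          fun_prop
        exact hf.indicator hset
      simp only [← lintegral_indicator measurableSet_Ioi]
      exact hk.lintegral_prod_right'
    rw [hκ φ hφ, hμ _ hmeas]
    refine lintegral_congr fun y => ?_
    rw [lintegral_logBetaMeasure hd hα (by fun_prop),
      ← lintegral_const_mul' _ _ ENNReal.ofReal_ne_top]
    have hv : exp (y / d) ^ (m - α) = exp y := by
      rw [← exp_mul, ← hd_def, div_mul_cancel₀ _ hd.ne']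
    rw [← hv, ← setLIntegral_Ioo_comp_div α m (exp_pos _)]
    refine setLIntegral_congr_fun measurableSet_Ioo fun u hu => ?_
    congr 2
    rw [add_div, exp_add, neg_div, mul_div_cancel_left₀ _ hd.ne', exp_neg, exp_log hu.1,
      ← div_eq_mul_inv]

/-- For `α > 0` and `m > α`, there exists a density solution on `(0,∞)`. -/
theorem exists_density_solution (α m : ℝ) (hα : 0 < α) (hm : α < m) :
    ∃ f : ℝ → ℝ, IsDensitySolution α m f := by
  obtain ⟨μ, hμ_fin, hμ_ne, hμ_Iic, hμ⟩ := exists_fixed_measure hα hm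
  have hΓ : 0 < Gamma α := Gamma_pos_of_pos hα
  let k : ℝ → ℝ → ℝ≥0∞ := fun v x =>
    (Ioo 0 x).indicator (fun v => ENNReal.ofReal (fracKernel α m v x)) v
  have hk : Measurable fun p : ℝ × ℝ => k p.1 p.2 := by
    have hset : MeasurableSet {p : ℝ × ℝ | 0 < p.1 ∧ p.1 < p.2} :=
      (measurableSet_lt measurable_const measurable_fst).inter
        (measurableSet_lt measurable_fst measurable_snd)
    have hf : Measurable fun p : ℝ × ℝ => ENNReal.ofReal (fracKernel α m p.1 p.2) := by
      unfold fracKernel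
      fun_prop
    exact hf.indicator hset
  have hk_left (x : ℝ) : Measurable fun v => k v x := hk.comp (measurable_id.prodMk measurable_const)
  let g : ℝ → ℝ≥0∞ := fun x => ∫⁻ v, k v x ∂μ
  have hg : Measurable g := hk.lintegral_prod_left'
  have hdens (φ : ℝ → ℝ≥0∞) (hφ : Measurable φ) :
      ∫⁻ x, φ x ∂μ = ∫⁻ x in Ioi 0, g x * φ x := by
    have hswap : ∫⁻ x in Ioi 0, g x * φ x = ∫⁻ v, (∫⁻ x in Ioi 0, k v x * φ x) ∂μ := by
      rw [lintegral_lintegral_swap (by fun_prop)]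
      refine lintegral_congr fun x => ?_
      rw [lintegral_mul_const _ (hk_left x)]
    rw [hμ φ hφ, hswap]
    have hpos : ∀ᵐ v ∂μ, v ∉ Iic (0 : ℝ) := measure_eq_zero_iff_ae_notMem.1 hμ_Iic
    refine lintegral_congr_ae ?_
    filter_upwards [hpos] with v hv
    have hv : 0 < v := not_le.1 hv
    rw [← lintegral_indicator measurableSet_Ioi, ← lintegral_indicator measurableSet_Ioi]
    refine lintegral_congr fun x => ?_
    by_cases hx : v < x
    · rw [indicator_of_mem (show x ∈ Ioi v from hx),
        indicator_of_mem (show x ∈ Ioi (0 : ℝ) from hv.trans hx)]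
      simp [k, hv, hx]
    · have hkx : k v x = 0 := indicator_of_notMem (fun h => hx h.2) _
      rw [indicator_of_notMem (show x ∉ Ioi v from hx)]
      simp [indicator_apply, hkx]
  have hmass : ∫⁻ x in Ioi 0, g x = μ univ := by
    rw [← lintegral_one, hdens _ measurable_const]
    simp
  have hμ_top : μ univ ≠ ∞ := measure_ne_top μ univ
  have hg_top : ∀ᵐ x ∂volume.restrict (Ioi (0 : ℝ)), g x < ∞ :=
    ae_lt_top hg (hmass.trans_ne hμ_top)
  set c := (μ univ).toReal with hc
  have hc_pos : 0 < c := ENNReal.toReal_pos (Measure.measure_univ_ne_zero.2 hμ_ne) hμ_top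
  refine ⟨fun x => (g x).toReal / c, hg.ennreal_toReal.div_const c, fun x _ => by positivity,
    ?_, fun x hx => ?_⟩
  · rw [integral_div, integral_toReal hg.aemeasurable hg_top, hmass, div_self hc_pos.ne']
  · have hx : 0 < x := hx
    have hgx : g x = ∫⁻ v in Ioo 0 x, g v * ENNReal.ofReal (fracKernel α m v x) := by
      change ∫⁻ v, k v x ∂μ = _
      rw [hdens _ (hk_left x), ← lintegral_indicator measurableSet_Ioi,
        ← lintegral_indicator measurableSet_Ioo]
      refine lintegral_congr fun v => ?_
      by_cases hv : v ∈ Ioo 0 x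
      · rw [indicator_of_mem hv, indicator_of_mem (show v ∈ Ioi (0 : ℝ) from hv.1)]
        simp [k, hv.1, hv.2]
      · rw [indicator_of_notMem hv]
        simp [k, indicator_of_notMem hv]
    have hgx_top : ∀ᵐ v ∂volume.restrict (Ioo 0 x),
        g v * ENNReal.ofReal (fracKernel α m v x) < ∞ := by
      filter_upwards [ae_restrict_of_ae_restrict_of_subset Ioo_subset_Ioi_self hg_top] with v hv
      exact ENNReal.mul_lt_top hv ENNReal.ofReal_lt_top
    have hreal : (g x).toReal =
        ∫ v in Ioo 0 x, (g v * ENNReal.ofReal (fracKernel α m v x)).toReal := by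
      rw [integral_toReal _ hgx_top, ← hgx]
      refine (hg.mul ?_).aemeasurable
      unfold fracKernel
      fun_prop
    dsimp only
    rw [hreal, ← integral_div, ← integral_const_mul, ← integral_const_mul]
    refine setIntegral_congr_fun measurableSet_Ioo fun v hv => ?_
    have hvx : 0 < x - v := sub_pos.2 hv.2
    have hker : 0 ≤ fracKernel α m v x := by
      unfold fracKernel
      positivity
    rw [ENNReal.toReal_mul, ENNReal.toReal_ofReal hker, fracKernel, rpow_neg hx.le]
    field_simp
end
end

section
/- Let α > 0 and m > α. If f and g are both density solutions to the equation x^m f(x) = (1/Γ(α)) ∫_0^x (x−v)^{α−1} f(v) dv on (0,∞), then f(x) = g(x) for every x > 0. -/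
open MeasureTheory Real Set Filter

noncomputable section

open scoped ENNReal Topology

lemma eq_of_convexOn_of_add_one_le {L K d e : ℝ → ℝ}
    (hL : ConvexOn ℝ (Ici 0) L) (hK : ConvexOn ℝ (Ici 0) K)
    (hL1 : ∀ u, 0 ≤ u → L (u + 1) = L u + d u) (hK1 : ∀ u, 0 ≤ u → K (u + 1) = K u + d u)
    (h0 : L 0 = K 0) (hd : ∀ᶠ n : ℕ in atTop, d (n + 1) - d n ≤ e n)
    (he : Tendsto (fun n : ℕ ↦ e n) atTop (𝓝 0)) {a : ℝ} (ha : a ∈ Ioo 0 1) : L a ≤ K a := by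
  obtain ⟨ha0, ha1⟩ := ha
  have hdiff : ∀ u, 0 ≤ u → ∀ n : ℕ, L (u + n) - K (u + n) = L u - K u := by
    intro u hu n
    induction n with
    | zero => simp
    | succ n ih =>
      have h : 0 ≤ u + n := by positivity
      push_cast
      rw [← add_assoc, hL1 _ h, hK1 _ h, ← ih]
      ring
  have hle : ∀ᶠ n : ℕ in atTop, L a - K a ≤ a * e n := by
    filter_upwards [hd] with n hn
    have hnn : (0 : ℝ) ≤ n := n.cast_nonneg
    have h1 := hdiff a ha0.le (n + 1)
    have h2 := hdiff 0 le_rfl (n + 1)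
    push_cast at h1 h2
    rw [zero_add, h0, sub_self] at h2
    have h3 := hL.2 (show (n : ℝ) + 1 ∈ Ici 0 by simp; positivity)
      (show (n : ℝ) + 1 + 1 ∈ Ici 0 by simp; positivity)
      (show 0 ≤ 1 - a by linarith) ha0.le (by ring)
    have h4 := hK.2 (show (n : ℝ) ∈ Ici 0 by simp)
      (show a + ((n : ℝ) + 1) ∈ Ici 0 by simp; positivity)
      (show 0 ≤ a / (1 + a) by positivity) (show 0 ≤ 1 / (1 + a) by positivity)
      (by field_simp; ring)
    simp only [smul_eq_mul] at h3 h4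
    rw [show (1 - a) * ((n : ℝ) + 1) + a * (n + 1 + 1) = a + (n + 1) by ring,
      hL1 (n + 1) (by positivity)] at h3
    rw [show a / (1 + a) * (n : ℝ) + 1 / (1 + a) * (a + (n + 1)) = n + 1 by field_simp; ring,
      show a / (1 + a) * K n + 1 / (1 + a) * K (a + (n + 1))
        = (a * K n + K (a + (n + 1))) / (1 + a) by ring, le_div_iff₀ (by positivity)] at h4
    have h5 := hK1 n hnn
    have h6 := mul_le_mul_of_nonneg_left hn ha0.le
    nlinarith
  have := ge_of_tendsto (he.const_mul a) hle
  linarith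

lemma log_Gamma_sub_le {x δ : ℝ} (hx : 0 < x) (hδ : 0 < δ) :
    log (Gamma (x + δ)) - log (Gamma x) ≤ δ * log (x + δ) := by
  have h := convexOn_log_Gamma.slope_mono_adjacent (x := x) (y := x + δ) (z := x + δ + 1)
    hx (show 0 < x + δ + 1 by positivity) (by linarith) (by linarith)
  have hy : 0 < x + δ := by positivity
  simp only [Function.comp_apply, add_sub_cancel_left, div_one] at h
  rw [Gamma_add_one hy.ne', log_mul hy.ne' (Gamma_pos_of_pos hy).ne', add_sub_cancel_right,
    div_le_iff₀ hδ] at h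
  linarith

lemma le_log_Gamma_sub {x δ : ℝ} (hx : 1 < x) (hδ : 0 < δ) :
    δ * log (x - 1) ≤ log (Gamma (x + δ)) - log (Gamma x) := by
  have hy : 0 < x - 1 := by linarith
  have h := convexOn_log_Gamma.slope_mono_adjacent (x := x - 1) (y := x) (z := x + δ)
    hy (show 0 < x + δ by linarith) (by linarith) (by linarith)
  have h1 : log (Gamma x) = log (x - 1) + log (Gamma (x - 1)) := by
    conv_lhs => rw [← sub_add_cancel x 1]
    rw [Gamma_add_one hy.ne', log_mul hy.ne' (Gamma_pos_of_pos hy).ne']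
  simp only [Function.comp_apply, add_sub_cancel_left, sub_sub_cancel, div_one] at h
  rw [le_div_iff₀ hδ, h1] at h
  linarith

lemma tendsto_log_affine_ratio {δ α : ℝ} (hδ : 0 < δ) :
    Tendsto (fun n : ℕ ↦ δ * log ((((n : ℝ) + 1) * δ + α + δ) / (((n : ℝ) + 1) * δ - 1)))
      atTop (𝓝 0) := by
  have h1 : Tendsto (fun n : ℕ ↦ ((n : ℝ) + 1) * δ - 1) atTop atTop :=
    tendsto_atTop_add_const_right _ _
      ((tendsto_atTop_add_const_right _ _ tendsto_natCast_atTop_atTop).atTop_mul_const hδ)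
  have h2 : Tendsto (fun n : ℕ ↦ 1 + (1 + α + δ) / (((n : ℝ) + 1) * δ - 1)) atTop (𝓝 1) := by
    simpa using tendsto_const_nhds.add (h1.const_div_atTop (1 + α + δ))
  have h3 : Tendsto (fun n : ℕ ↦ (((n : ℝ) + 1) * δ + α + δ) / (((n : ℝ) + 1) * δ - 1))
      atTop (𝓝 1) := by
    refine h2.congr' ?_
    filter_upwards [h1.eventually_gt_atTop 0] with n hn
    rw [one_add_div hn.ne']
    ring
  simpa using (h3.log one_ne_zero).const_mul δ

lemma map_eq_of_mgf_eqOn {Ω : Type*} [MeasurableSpace Ω] {μ ν : Measure Ω}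
    [IsFiniteMeasure μ] [IsFiniteMeasure ν] {X : Ω → ℝ} (hX : Measurable X) {δ : ℝ} (hδ : 0 < δ)
    (hμ : Ioo (-δ) δ ⊆ ProbabilityTheory.integrableExpSet X μ)
    (hν : Ioo (-δ) δ ⊆ ProbabilityTheory.integrableExpSet X ν)
    (h : EqOn (ProbabilityTheory.mgf X μ) (ProbabilityTheory.mgf X ν) (Ioo (-δ) 0)) :
    μ.map X = ν.map X := by
  have hμ' := interior_maximal hμ isOpen_Ioo
  have hν' := interior_maximal hν isOpen_Ioo
  have hfreq : ∃ᶠ z in 𝓝[≠] ((-δ / 2 : ℝ) : ℂ),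
      ProbabilityTheory.complexMGF X μ z = ProbabilityTheory.complexMGF X ν z := by
    have hev : ∀ᶠ x : ℝ in 𝓝[≠] (-δ / 2), ProbabilityTheory.complexMGF X μ x
        = ProbabilityTheory.complexMGF X ν x := by
      have : Ioo (-δ) 0 ∈ 𝓝 (-δ / 2) := Ioo_mem_nhds (by linarith) (by linarith)
      filter_upwards [mem_nhdsWithin_of_mem_nhds this] with x hx
      rw [ProbabilityTheory.complexMGF_ofReal, ProbabilityTheory.complexMGF_ofReal, h hx]
    refine Tendsto.frequently (f := ((↑) : ℝ → ℂ)) ?_ hev.frequently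
    refine tendsto_nhdsWithin_of_tendsto_nhds_of_eventually_within _
      (Complex.continuous_ofReal.continuousAt.mono_left nhdsWithin_le_nhds) ?_
    filter_upwards [self_mem_nhdsWithin] with x hx
    exact fun h ↦ hx (Complex.ofReal_injective h)
  have hEq : EqOn (ProbabilityTheory.complexMGF X μ) (ProbabilityTheory.complexMGF X ν)
      {z | z.re ∈ Ioo (-δ) δ} := by
    refine AnalyticOnNhd.eqOn_of_preconnected_of_frequently_eq
      (ProbabilityTheory.analyticOnNhd_complexMGF.mono fun z hz ↦ hμ' hz)
      (ProbabilityTheory.analyticOnNhd_complexMGF.mono fun z hz ↦ hν' hz)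
      ((convex_Ioo _ _).linear_preimage Complex.reLm).isPreconnected
      (z₀ := ((-δ / 2 : ℝ) : ℂ)) ?_ hfreq
    simp only [mem_ofPred_eq, Complex.ofReal_re]
    constructor <;> linarith
  refine Measure.ext_of_charFun ?_
  ext t
  rw [← ProbabilityTheory.complexMGF_mul_I hX.aemeasurable,
    ← ProbabilityTheory.complexMGF_mul_I hX.aemeasurable]
  refine hEq ?_
  simp [hδ]

lemma lintegral_Ioi_rpow_mul_sub_rpow {α t v : ℝ} (hα : 0 < α) (ht : t < 0) (hv : 0 < v) :
    ∫⁻ x in Ioi v, ENNReal.ofReal (x ^ (t - α)) * ENNReal.ofReal ((x - v) ^ (α - 1))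
      = ENNReal.ofReal (v ^ t) * ENNReal.ofReal (ProbabilityTheory.beta (-t) α) := by
  have himg : (fun w : ℝ ↦ v / w) '' Ioo 0 1 = Ioi v := by
    ext x
    simp only [mem_image, mem_Ioo, mem_Ioi]
    constructor
    · rintro ⟨w, ⟨h0, h1⟩, rfl⟩
      rw [lt_div_iff₀ h0]
      nlinarith
    · intro hx
      have hx0 : 0 < x := hv.trans hx
      exact ⟨v / x, ⟨by positivity, (div_lt_one hx0).2 hx⟩, by field_simp⟩
  have hB := ProbabilityTheory.beta_pos (neg_pos.2 ht) hα
  rw [← himg, lintegral_image_eq_lintegral_abs_deriv_mul (f' := fun w ↦ -v / w ^ 2)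
    measurableSet_Ioo]
  · have h1 := ProbabilityTheory.lintegral_betaPDF_eq_one (neg_pos.2 ht) hα
    rw [ProbabilityTheory.lintegral_betaPDF] at h1
    rw [← mul_one (_ * _), ← h1, ← lintegral_const_mul _ (by fun_prop)]
    refine setLIntegral_congr_fun measurableSet_Ioo fun w ⟨h0, h1⟩ ↦ ?_
    have hw1 : 0 < 1 - w := by linarith
    have hvw : v / w - v = v * (1 - w) * w⁻¹ := by field_simp
    rw [← ENNReal.ofReal_mul (by positivity), ← ENNReal.ofReal_mul (by positivity),
      ← ENNReal.ofReal_mul (by positivity), ← ENNReal.ofReal_mul (by positivity)]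
    congr 1
    have habs : |-v / w ^ 2| = v * w ^ (-2 : ℝ) := by
      rw [neg_div, abs_neg, abs_of_pos (by positivity), rpow_neg h0.le]
      norm_cast
    rw [habs, hvw, div_eq_mul_inv, ← rpow_neg_one w, mul_rpow hv.le (by positivity),
      mul_rpow (by positivity) (by positivity), mul_rpow hv.le hw1.le,
      ← rpow_mul h0.le, ← rpow_mul h0.le]
    have e1 : v ^ t = v * v ^ (t - α) * v ^ (α - 1) := by
      rw [mul_assoc, ← rpow_add hv, ← rpow_one_add' hv.le (by linarith)]
      congr 1; ring
    have e2 : w ^ (-t - 1) = w ^ (-2 : ℝ) * w ^ (-1 * (t - α)) * w ^ (-1 * (α - 1)) := by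
      rw [← rpow_add h0, ← rpow_add h0]
      congr 1; ring
    rw [e1, e2]
    field_simp
  · intro w hw
    have hw0 : w ≠ 0 := hw.1.ne'
    have := ((hasDerivAt_const w v).div (hasDerivAt_id w) hw0).hasDerivWithinAt (s := Ioo 0 1)
    simp only [zero_mul, id_eq, mul_one, zero_sub] at this
    exact this
  · intro x hx y hy hxy
    have h1 := hx.1.ne'
    have h2 := hy.1.ne'
    simp only at hxy
    field_simp at hxy
    exact hxy.symm

/-- The moment of order `t` of the density `f` on `(0,∞)`, as an extended nonnegative real. -/
def rpowMoment (f : ℝ → ℝ) (t : ℝ) : ℝ≥0∞ :=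
  ∫⁻ x in Ioi 0, ENNReal.ofReal (x ^ t) * ENNReal.ofReal (f x)

lemma rpowMoment_convex_combination_le {f : ℝ → ℝ} (hf : Measurable f) (s t : ℝ) {p q : ℝ}
    (hp : 0 ≤ p) (hq : 0 ≤ q) (hpq : p + q = 1) :
    rpowMoment f (p * s + q * t) ≤ rpowMoment f s ^ p * rpowMoment f t ^ q := by
  refine le_trans (le_of_eq ?_) (ENNReal.lintegral_mul_norm_pow_le
    (f := fun x ↦ ENNReal.ofReal (x ^ s) * ENNReal.ofReal (f x))
    (g := fun x ↦ ENNReal.ofReal (x ^ t) * ENNReal.ofReal (f x))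
    (by fun_prop) (by fun_prop) hp hq hpq)
  refine setLIntegral_congr_fun measurableSet_Ioi fun x (hx : 0 < x) ↦ ?_
  have h1 : ENNReal.ofReal (x ^ (p * s + q * t))
      = ENNReal.ofReal (x ^ s) ^ p * ENNReal.ofReal (x ^ t) ^ q := by
    rw [ENNReal.ofReal_rpow_of_nonneg (by positivity) hp,
      ENNReal.ofReal_rpow_of_nonneg (by positivity) hq, ← ENNReal.ofReal_mul (by positivity),
      ← rpow_mul hx.le, ← rpow_mul hx.le, ← rpow_add hx, mul_comm s, mul_comm t]
  have h2 : ENNReal.ofReal (f x) = ENNReal.ofReal (f x) ^ p * ENNReal.ofReal (f x) ^ q := by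
    rw [← ENNReal.rpow_add_of_nonneg _ _ hp hq, hpq, ENNReal.rpow_one]
  rw [ENNReal.mul_rpow_of_nonneg _ _ hp, ENNReal.mul_rpow_of_nonneg _ _ hq, h1]
  nth_rw 1 [h2]
  ring

namespace IsDensitySolution

variable {α m : ℝ} {f g : ℝ → ℝ}

lemma integrableOn (hf : IsDensitySolution α m f) : IntegrableOn f (Ioi 0) := by
  by_contra h
  have h1 := hf.2.2.1
  rw [integral_undef h] at h1
  exact zero_ne_one h1

lemma lintegral_ofReal_eq_one (hf : IsDensitySolution α m f) :
    ∫⁻ x in Ioi 0, ENNReal.ofReal (f x) = 1 := by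
  rw [← ofReal_integral_eq_lintegral_ofReal hf.integrableOn, hf.2.2.1, ENNReal.ofReal_one]
  exact ae_restrict_of_forall_mem measurableSet_Ioi hf.2.1

lemma rpowMoment_zero (hf : IsDensitySolution α m f) : rpowMoment f 0 = 1 := by
  simp [rpowMoment, hf.lintegral_ofReal_eq_one]

lemma rpowMoment_ne_zero (hf : IsDensitySolution α m f) (t : ℝ) : rpowMoment f t ≠ 0 := by
  have hfm : Measurable f := hf.1
  intro h
  rw [rpowMoment, lintegral_eq_zero_iff (by fun_prop)] at h
  have h1 := hf.lintegral_ofReal_eq_one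
  rw [lintegral_congr_ae (g := 0)] at h1
  · simp at h1
  · filter_upwards [h, ae_restrict_mem measurableSet_Ioi] with x hx (hx0 : 0 < x)
    simp only [Pi.zero_apply, mul_eq_zero, ENNReal.ofReal_eq_zero] at hx
    have : ¬ x ^ t ≤ 0 := not_le.2 (by positivity)
    simpa [this] using hx

/-- The kernel `y ↦ y^(α-1)` on `(0,∞)`, extended by zero. -/
def fracKernel (α y : ℝ) : ℝ≥0∞ :=
  (Ioi (0 : ℝ)).indicator (fun y ↦ ENNReal.ofReal (y ^ (α - 1))) y

@[fun_prop]
lemma measurable_fracKernel (α : ℝ) : Measurable (fracKernel α) :=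
  Measurable.indicator (by fun_prop) measurableSet_Ioi

lemma setLIntegral_Ioo_eq_fracKernel (α x : ℝ) (f : ℝ → ℝ) :
    ∫⁻ v in Ioo 0 x, ENNReal.ofReal ((x - v) ^ (α - 1)) * ENNReal.ofReal (f v)
      = ∫⁻ v in Ioi 0, fracKernel α (x - v) * ENNReal.ofReal (f v) := by
  rw [← Ioi_inter_Iio, inter_comm, ← setLIntegral_indicator measurableSet_Iio]
  refine lintegral_congr fun v ↦ ?_
  by_cases h : v < x <;> simp [fracKernel, indicator, h]

lemma ae_lintegral_fracKernel_lt_top (hα : 0 < α) (hf : IsDensitySolution α m f) :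
    ∀ᵐ x ∂(volume.restrict (Ioi 0)),
      ∫⁻ v in Ioi 0, fracKernel α (x - v) * ENNReal.ofReal (f v) < ∞ := by
  have hfm : Measurable f := hf.1
  have key : ∀ n : ℕ, ∀ᵐ x : ℝ, x < n →
      ∫⁻ v in Ioi 0, fracKernel α (x - v) * ENNReal.ofReal (f v) < ∞ := by
    intro n
    set k : ℝ → ℝ≥0∞ := (Iio (n : ℝ)).indicator (fracKernel α) with hk_def
    have hk : Measurable k := (measurable_fracKernel α).indicator measurableSet_Iio
    have hkfin : ∫⁻ y, k y ≠ ∞ := by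
      rw [hk_def, lintegral_indicator measurableSet_Iio]
      simp only [fracKernel]
      rw [setLIntegral_indicator measurableSet_Ioi, Ioi_inter_Iio]
      have h := (intervalIntegral.intervalIntegrable_rpow' (a := 0) (b := n)
        (show -1 < α - 1 by linarith))
      rw [intervalIntegrable_iff_integrableOn_Ioo_of_le n.cast_nonneg] at h
      exact h.lintegral_lt_top.ne
    have hfin : ∫⁻ x, ∫⁻ v in Ioi 0, k (x - v) * ENNReal.ofReal (f v) ≠ ∞ := by
      rw [lintegral_lintegral_swap (by fun_prop)]
      have h : ∀ v, ∫⁻ x, k (x - v) * ENNReal.ofReal (f v)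
          = (∫⁻ y, k y) * ENNReal.ofReal (f v) := fun v ↦ by
        rw [lintegral_mul_const _ (by fun_prop), lintegral_sub_right_eq_self]
      simp_rw [h]
      rw [lintegral_const_mul _ (by fun_prop), hf.lintegral_ofReal_eq_one, mul_one]
      exact hkfin
    filter_upwards [ae_lt_top (by fun_prop) hfin] with x hx hxn
    refine lt_of_le_of_lt (le_of_eq ?_) hx
    refine setLIntegral_congr_fun measurableSet_Ioi fun v (hv : 0 < v) ↦ ?_
    simp only [hk_def]
    rw [indicator_of_mem (show x - v ∈ Iio (n : ℝ) by simp; linarith)]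
  refine ae_restrict_of_ae ?_
  filter_upwards [ae_all_iff.2 key] with x hx
  obtain ⟨n, hn⟩ := exists_nat_gt x
  exact hx n hn

lemma ae_ofReal_rpow_mul_eq (hα : 0 < α) (hf : IsDensitySolution α m f) :
    ∀ᵐ x ∂(volume.restrict (Ioi 0)), ENNReal.ofReal (x ^ m) * ENNReal.ofReal (f x)
      = ENNReal.ofReal (1 / Gamma α) *
        ∫⁻ v in Ioi 0, fracKernel α (x - v) * ENNReal.ofReal (f v) := by
  have hfm : Measurable f := hf.1
  filter_upwards [hf.ae_lintegral_fracKernel_lt_top hα, ae_restrict_mem measurableSet_Ioi]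
    with x hx (hx0 : 0 < x)
  rw [← setLIntegral_Ioo_eq_fracKernel] at hx ⊢
  have hcongr : ∫⁻ v in Ioo 0 x, ENNReal.ofReal ((x - v) ^ (α - 1)) * ENNReal.ofReal (f v)
      = ∫⁻ v in Ioo 0 x, ENNReal.ofReal ((x - v) ^ (α - 1) * f v) :=
    setLIntegral_congr_fun measurableSet_Ioo fun v hv ↦
      (ENNReal.ofReal_mul (rpow_nonneg (sub_nonneg.2 hv.2.le) _)).symm
  have hnn : ∀ᵐ v ∂(volume.restrict (Ioo 0 x)), 0 ≤ (x - v) ^ (α - 1) * f v :=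
    ae_restrict_of_forall_mem measurableSet_Ioo fun v hv ↦
      mul_nonneg (rpow_nonneg (sub_nonneg.2 hv.2.le) _) (hf.2.1 v hv.1)
  rw [hcongr] at hx ⊢
  rw [← ENNReal.ofReal_mul (by positivity), hf.2.2.2 x hx0,
    ENNReal.ofReal_mul (one_div_nonneg.2 (Gamma_pos_of_pos hα).le),
    integral_eq_lintegral_of_nonneg_ae hnn (by fun_prop), ENNReal.ofReal_toReal hx.ne]

lemma rpowMoment_add (hα : 0 < α) (hf : IsDensitySolution α m f) {t : ℝ} (ht : t < 0) :
    rpowMoment f (t + (m - α))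
      = ENNReal.ofReal (Gamma (-t) / Gamma (α - t)) * rpowMoment f t := by
  have hfm : Measurable f := hf.1
  have hG := Gamma_pos_of_pos hα
  calc rpowMoment f (t + (m - α))
      = ∫⁻ x in Ioi 0, ENNReal.ofReal (1 / Gamma α) * ∫⁻ v in Ioi 0,
          ENNReal.ofReal (x ^ (t - α)) * (fracKernel α (x - v) * ENNReal.ofReal (f v)) := by
        refine lintegral_congr_ae ?_
        filter_upwards [hf.ae_ofReal_rpow_mul_eq hα, ae_restrict_mem measurableSet_Ioi]
          with x hx (hx0 : 0 < x)
        rw [lintegral_const_mul _ (by fun_prop), mul_left_comm, ← hx, ← mul_assoc,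
          ← ENNReal.ofReal_mul (rpow_nonneg hx0.le (t - α)), ← rpow_add hx0]
        congr 3
        ring
    _ = ENNReal.ofReal (1 / Gamma α) * ∫⁻ v in Ioi 0, ∫⁻ x in Ioi 0,
          ENNReal.ofReal (x ^ (t - α)) * (fracKernel α (x - v) * ENNReal.ofReal (f v)) := by
        rw [lintegral_const_mul _ (by fun_prop), lintegral_lintegral_swap (by fun_prop)]
    _ = ENNReal.ofReal (1 / Gamma α) * ∫⁻ v in Ioi 0,
          ENNReal.ofReal (ProbabilityTheory.beta (-t) α) *
            (ENNReal.ofReal (v ^ t) * ENNReal.ofReal (f v)) := by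
        congr 1
        refine setLIntegral_congr_fun measurableSet_Ioi fun v (hv : 0 < v) ↦ ?_
        simp_rw [← mul_assoc]
        rw [lintegral_mul_const _ (by fun_prop), mul_comm (ENNReal.ofReal _) (ENNReal.ofReal _),
          ← lintegral_Ioi_rpow_mul_sub_rpow hα ht hv]
        congr 1
        have hsub : Ioi v = Ioi v ∩ Ioi 0 := by rw [Ioi_inter_Ioi, sup_of_le_left hv.le]
        rw [hsub, ← setLIntegral_indicator measurableSet_Ioi]
        refine lintegral_congr fun x ↦ ?_
        by_cases h : v < x <;> simp [fracKernel, indicator, h]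
    _ = ENNReal.ofReal (Gamma (-t) / Gamma (α - t)) * rpowMoment f t := by
        rw [lintegral_const_mul _ (by fun_prop), ← mul_assoc,
          ← ENNReal.ofReal_mul (by positivity), rpowMoment, ProbabilityTheory.beta,
          neg_add_eq_sub]
        congr 2
        field_simp

lemma rpowMoment_ne_top_of_nonpos (hα : 0 < α) (hm : α < m) (hf : IsDensitySolution α m f) {t : ℝ}
    (ht : t ≤ 0) : rpowMoment f t ≠ ∞ := by
  have hδ : 0 < m - α := sub_pos.2 hm
  have hnat : ∀ n : ℕ, rpowMoment f (-(n * (m - α))) ≠ ∞ := by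
    intro n
    induction n with
    | zero => simp [hf.rpowMoment_zero]
    | succ n ih =>
      have hpos : 0 < ((n + 1 : ℕ) : ℝ) * (m - α) := by positivity
      have h := hf.rpowMoment_add hα (neg_lt_zero.2 hpos)
      rw [show -(((n + 1 : ℕ) : ℝ) * (m - α)) + (m - α) = -(n * (m - α)) by push_cast; ring] at h
      intro htop
      rw [htop, ENNReal.mul_top] at h
      · exact ih h
      · rw [Ne, ENNReal.ofReal_eq_zero, not_le, neg_neg, sub_neg_eq_add]
        exact div_pos (Gamma_pos_of_pos hpos) (Gamma_pos_of_pos (by positivity))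
  obtain ⟨n, hn⟩ := exists_nat_gt (-t / (m - α))
  rw [div_lt_iff₀ hδ] at hn
  have hn0 : 0 < n * (m - α) := by linarith
  have h := rpowMoment_convex_combination_le hf.1 0 (-(n * (m - α)))
    (p := 1 - -t / (n * (m - α))) (q := -t / (n * (m - α)))
    (sub_nonneg.2 ((div_le_one hn0).2 hn.le)) (div_nonneg (by linarith) hn0.le) (by ring)
  rw [mul_zero, zero_add, mul_neg, div_mul_cancel₀ _ hn0.ne', neg_neg, hf.rpowMoment_zero,
    ENNReal.one_rpow, one_mul] at h
  exact ne_top_of_le_ne_top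
    (ENNReal.rpow_ne_top_of_nonneg (div_nonneg (by linarith) hn0.le) (hnat n)) h

lemma rpowMoment_ne_top (hα : 0 < α) (hm : α < m) (hf : IsDensitySolution α m f) {t : ℝ}
    (ht : t < m - α) : rpowMoment f t ≠ ∞ := by
  have h := hf.rpowMoment_add hα (sub_neg.2 ht)
  rw [sub_add_cancel] at h
  rw [h]
  exact ENNReal.mul_ne_top ENNReal.ofReal_ne_top
    (hf.rpowMoment_ne_top_of_nonpos hα hm (sub_neg.2 ht).le)

lemma convexOn_log_rpowMoment (hα : 0 < α) (hm : α < m) (hf : IsDensitySolution α m f) :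
    ConvexOn ℝ (Ici 0) fun u ↦ log (rpowMoment f (-(u * (m - α)))).toReal := by
  have hδ : 0 < m - α := sub_pos.2 hm
  refine ⟨convex_Ici 0, fun x (hx : 0 ≤ x) y (hy : 0 ≤ y) p q hp hq hpq ↦ ?_⟩
  have hfin : ∀ u, 0 ≤ u → rpowMoment f (-(u * (m - α))) ≠ ∞ := fun u hu ↦
    hf.rpowMoment_ne_top_of_nonpos hα hm (neg_nonpos.2 (by positivity))
  have hpos : ∀ u, 0 ≤ u → 0 < (rpowMoment f (-(u * (m - α)))).toReal := fun u hu ↦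
    ENNReal.toReal_pos (hf.rpowMoment_ne_zero _) (hfin u hu)
  have h := rpowMoment_convex_combination_le hf.1 (-(x * (m - α))) (-(y * (m - α))) hp hq hpq
  have h' := ENNReal.toReal_mono (ENNReal.mul_ne_top
    (ENNReal.rpow_ne_top_of_nonneg hp (hfin x hx))
    (ENNReal.rpow_ne_top_of_nonneg hq (hfin y hy))) h
  rw [ENNReal.toReal_mul, ← ENNReal.toReal_rpow, ← ENNReal.toReal_rpow,
    show p * -(x * (m - α)) + q * -(y * (m - α)) = -((p * x + q * y) * (m - α)) by ring] at h'
  have hx' := hpos x hx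
  have hy' := hpos y hy
  simp only [smul_eq_mul]
  rw [← log_rpow hx', ← log_rpow hy', ← log_mul (by positivity) (by positivity)]
  exact log_le_log (hpos _ (by positivity)) h'

lemma log_rpowMoment_add_one (hα : 0 < α) (hm : α < m) (hf : IsDensitySolution α m f) {u : ℝ}
    (hu : 0 ≤ u) :
    log (rpowMoment f (-((u + 1) * (m - α)))).toReal
      = log (rpowMoment f (-(u * (m - α)))).toReal
        + (log (Gamma ((u + 1) * (m - α) + α)) - log (Gamma ((u + 1) * (m - α)))) := by
  have hδ : 0 < m - α := sub_pos.2 hm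
  have hpos : 0 < (u + 1) * (m - α) := by positivity
  have hG1 := Gamma_pos_of_pos hpos
  have hG2 := Gamma_pos_of_pos (show 0 < (u + 1) * (m - α) + α by positivity)
  have h := hf.rpowMoment_add hα (neg_lt_zero.2 hpos)
  rw [show -((u + 1) * (m - α)) + (m - α) = -(u * (m - α)) by ring, neg_neg, sub_neg_eq_add,
    add_comm α] at h
  have hM := ENNReal.toReal_pos (hf.rpowMoment_ne_zero _)
    (hf.rpowMoment_ne_top_of_nonpos hα hm (neg_nonpos.2 hpos.le))
  rw [h, ENNReal.toReal_mul, ENNReal.toReal_ofReal (by positivity),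
    log_mul (by positivity) hM.ne', log_div hG1.ne' hG2.ne']
  ring

lemma log_rpowMoment_le (hα : 0 < α) (hm : α < m) (hf : IsDensitySolution α m f)
    (hg : IsDensitySolution α m g) {a : ℝ} (ha : a ∈ Ioo 0 1) :
    log (rpowMoment f (-(a * (m - α)))).toReal ≤ log (rpowMoment g (-(a * (m - α)))).toReal := by
  have hδ : 0 < m - α := sub_pos.2 hm
  refine eq_of_convexOn_of_add_one_le
    (d := fun u ↦ log (Gamma ((u + 1) * (m - α) + α)) - log (Gamma ((u + 1) * (m - α))))
    (e := fun u ↦ (m - α) * log (((u + 1) * (m - α) + α + (m - α)) / ((u + 1) * (m - α) - 1)))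
    (hf.convexOn_log_rpowMoment hα hm) (hg.convexOn_log_rpowMoment hα hm)
    (fun u hu ↦ hf.log_rpowMoment_add_one hα hm hu)
    (fun u hu ↦ hg.log_rpowMoment_add_one hα hm hu)
    (by simp [hf.rpowMoment_zero, hg.rpowMoment_zero]) ?_ (tendsto_log_affine_ratio hδ) ha
  have h1 : Tendsto (fun n : ℕ ↦ ((n : ℝ) + 1) * (m - α)) atTop atTop :=
    (tendsto_atTop_add_const_right _ _ tendsto_natCast_atTop_atTop).atTop_mul_const hδ
  filter_upwards [h1.eventually_gt_atTop 1] with n hn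
  have hlo := le_log_Gamma_sub hn hδ
  have hup := log_Gamma_sub_le (show 0 < ((n : ℝ) + 1) * (m - α) + α by linarith) hδ
  rw [log_div (by linarith) (by linarith),
    show ((n : ℝ) + 1 + 1) * (m - α) = (n + 1) * (m - α) + (m - α) by ring,
    add_right_comm _ (m - α) α]
  linarith

lemma rpowMoment_eq (hα : 0 < α) (hm : α < m) (hf : IsDensitySolution α m f)
    (hg : IsDensitySolution α m g) {t : ℝ} (ht : t ∈ Ioo (-(m - α)) 0) :
    rpowMoment f t = rpowMoment g t := by
  have hδ : 0 < m - α := sub_pos.2 hm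
  have ha : -t / (m - α) ∈ Ioo (0 : ℝ) 1 :=
    ⟨div_pos (neg_pos.2 ht.2) hδ, (div_lt_one hδ).2 (by linarith [ht.1])⟩
  have h := (hf.log_rpowMoment_le hα hm hg ha).antisymm (hg.log_rpowMoment_le hα hm hf ha)
  rw [div_mul_cancel₀ _ hδ.ne', neg_neg] at h
  have hft := hf.rpowMoment_ne_top_of_nonpos hα hm ht.2.le
  have hgt := hg.rpowMoment_ne_top_of_nonpos hα hm ht.2.le
  exact (ENNReal.toReal_eq_toReal_iff' hft hgt).1 <|
    log_injOn_pos (ENNReal.toReal_pos (hf.rpowMoment_ne_zero t) hft)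
      (ENNReal.toReal_pos (hg.rpowMoment_ne_zero t) hgt) h

/-- The probability measure on `ℝ` with density `f` on `(0,∞)`. -/
def law (f : ℝ → ℝ) : Measure ℝ :=
  (volume.restrict (Ioi 0)).withDensity fun x ↦ ENNReal.ofReal (f x)

lemma lintegral_exp_mul_log_law (hf : Measurable f) (t : ℝ) :
    ∫⁻ x, ENNReal.ofReal (exp (t * log x)) ∂(law f) = rpowMoment f t := by
  rw [law, lintegral_withDensity_eq_lintegral_mul _ (by fun_prop) (by fun_prop), rpowMoment]
  refine setLIntegral_congr_fun measurableSet_Ioi fun x (hx : 0 < x) ↦ ?_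
  rw [Pi.mul_apply, mul_comm, rpow_def_of_pos hx, mul_comm t]

lemma mgf_log_law (hf : Measurable f) (t : ℝ) :
    ProbabilityTheory.mgf log (law f) t = (rpowMoment f t).toReal := by
  rw [ProbabilityTheory.mgf, integral_eq_lintegral_of_nonneg_ae
    (ae_of_all _ fun x ↦ (exp_pos _).le) (by fun_prop), lintegral_exp_mul_log_law hf]

lemma mem_integrableExpSet_log_law (hf : Measurable f) {t : ℝ} (h : rpowMoment f t ≠ ∞) :
    t ∈ ProbabilityTheory.integrableExpSet log (law f) := by
  refine ⟨by fun_prop, ?_⟩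
  rw [hasFiniteIntegral_iff_ofReal (ae_of_all _ fun x ↦ (exp_pos _).le),
    lintegral_exp_mul_log_law hf]
  exact h.lt_top

lemma isFiniteMeasure_law (hf : IsDensitySolution α m f) : IsFiniteMeasure (law f) :=
  isFiniteMeasure_withDensity (by simp [hf.lintegral_ofReal_eq_one])

lemma ae_pos_law (f : ℝ → ℝ) : ∀ᵐ x ∂(law f), 0 < x :=
  (withDensity_absolutelyContinuous _ _).ae_le (ae_restrict_mem measurableSet_Ioi)

lemma law_eq (hα : 0 < α) (hm : α < m) (hf : IsDensitySolution α m f)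
    (hg : IsDensitySolution α m g) : law f = law g := by
  have := hf.isFiniteMeasure_law
  have := hg.isFiniteMeasure_law
  have hmap : (law f).map log = (law g).map log := by
    refine map_eq_of_mgf_eqOn measurable_log (sub_pos.2 hm)
      (fun t ht ↦ mem_integrableExpSet_log_law hf.1 (hf.rpowMoment_ne_top hα hm ht.2))
      (fun t ht ↦ mem_integrableExpSet_log_law hg.1 (hg.rpowMoment_ne_top hα hm ht.2))
      fun t ht ↦ ?_
    rw [mgf_log_law hf.1, mgf_log_law hg.1, hf.rpowMoment_eq hα hm hg ht]
  have hid : ∀ h : ℝ → ℝ, ((law h).map log).map exp = law h := fun h ↦ by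
    rw [Measure.map_map measurable_exp measurable_log,
      Measure.map_congr (g := id) _, Measure.map_id]
    filter_upwards [ae_pos_law h] with x hx
    exact exp_log hx
  rw [← hid f, hmap, hid g]

lemma ae_eq (hα : 0 < α) (hm : α < m) (hf : IsDensitySolution α m f)
    (hg : IsDensitySolution α m g) : f =ᵐ[volume.restrict (Ioi 0)] g := by
  have hfm : Measurable f := hf.1
  have hgm : Measurable g := hg.1
  have h := (withDensity_eq_iff (by fun_prop) (by fun_prop)
    (by simp [hf.lintegral_ofReal_eq_one])).1 (hf.law_eq hα hm hg)
  filter_upwards [h, ae_restrict_mem measurableSet_Ioi] with x hx hx0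
  exact (ENNReal.ofReal_eq_ofReal_iff (hf.2.1 x hx0) (hg.2.1 x hx0)).1 hx

end IsDensitySolution

/-- For `α > 0` and `m > α`, the density solution is unique on `(0,∞)`. -/
theorem density_solution_unique (α m : ℝ) (hα : 0 < α) (hm : α < m)
    (f g : ℝ → ℝ) (hf : IsDensitySolution α m f) (hg : IsDensitySolution α m g) :
    ∀ x ∈ Set.Ioi (0:ℝ), f x = g x := by
  intro x (hx : 0 < x)
  have hint : ∫ v in Ioo 0 x, (x - v) ^ (α - 1) * f v
      = ∫ v in Ioo 0 x, (x - v) ^ (α - 1) * g v := by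
    refine integral_congr_ae ?_
    filter_upwards [ae_restrict_of_ae_restrict_of_subset Ioo_subset_Ioi_self
      (hf.ae_eq hα hm hg)] with v hv
    rw [hv]
  have h := hf.2.2.2 x hx
  rw [hint, ← hg.2.2.2 x hx] at h
  exact mul_left_cancel₀ (rpow_pos_of_pos hx m).ne' h
end
end

section
/- Let α > 0, m > α, set a = m − α, and let f be the unique density solution to the equation x^m f(x) = (1/Γ(α)) ∫_0^x (x−v)^{α−1} f(v) dv on (0,∞). Then for every s > −a, the Mellin transform M(s) = ∫_0^∞ x^{−s} f(x) dx is finite and equals the limit, as N → ∞, of (a^{(m−a)/a} Γ(m/a))^s · ∏_{n=0}^{N} [ ((m+an)/(a+an))^s · Γ(a+an+s) Γ(m+an) / ( Γ(a+an) Γ(m+an+s) ) ]. -/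
open MeasureTheory Real Set Filter

noncomputable section

open scoped Topology ENNReal

section Asymptotics

/-- The increment of a convex function over a step `s > 0` is controlled, at logarithmic scale, by
its increments over a fixed step `a`. -/
lemma ConvexOn.tendsto_add_sub_sub_log_of_pos {G : ℝ → ℝ} {c a l s : ℝ}
    (hG : ConvexOn ℝ (Ioi c) G) (ha : 0 < a) (hs : 0 < s)
    (h : Tendsto (fun x => G (x + a) - G x - l * log x) atTop (𝓝 0)) :
    Tendsto (fun x => G (x + s) - G x - s / a * l * log x) atTop (𝓝 0) := by
  have hlog (y : ℝ) : Tendsto (fun x : ℝ => log (x + y) - log x) atTop (𝓝 0) :=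
    tendsto_log_comp_add_sub_log y
  have hshift (y : ℝ) :
      Tendsto (fun x => s / a * (G (x + y + a) - G (x + y) - l * log x)) atTop (𝓝 0) := by
    have := (((h.comp (tendsto_atTop_add_const_right atTop y tendsto_id)).add
      ((hlog y).const_mul l)).const_mul (s / a))
    simp only [mul_zero, add_zero] at this
    refine this.congr fun x => ?_
    simp only [Function.comp_apply, id]
    ring
  refine tendsto_of_tendsto_of_tendsto_of_le_of_le' (hshift (-a)) (hshift s) ?_ ?_
  · filter_upwards [eventually_gt_atTop (c + a)] with x hx
    have := hG.slope_mono_adjacent (x := x - a) (y := x) (z := x + s) (mem_Ioi.2 (by linarith))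
      (mem_Ioi.2 (by linarith)) (by linarith) (by linarith)
    rw [sub_sub_cancel, add_sub_cancel_left, div_le_div_iff₀ ha hs] at this
    have h2 : s / a * (G x - G (x - a)) ≤ G (x + s) - G x := by
      rw [div_mul_eq_mul_div, div_le_iff₀ ha]; linarith
    rw [neg_add_cancel_right, ← sub_eq_add_neg]
    linarith
  · filter_upwards [eventually_gt_atTop c] with x hx
    have := hG.slope_mono_adjacent (x := x) (y := x + s) (z := x + s + a) (mem_Ioi.2 (by linarith))
      (mem_Ioi.2 (by linarith)) (by linarith) (by linarith)
    rw [add_sub_cancel_left, add_sub_cancel_left, div_le_div_iff₀ hs ha] at this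
    have h2 : G (x + s) - G x ≤ s / a * (G (x + s + a) - G (x + s)) := by
      rw [div_mul_eq_mul_div, le_div_iff₀ ha]; linarith
    linarith

lemma ConvexOn.tendsto_add_sub_sub_log {G : ℝ → ℝ} {c a l : ℝ}
    (hG : ConvexOn ℝ (Ioi c) G) (ha : 0 < a) (s : ℝ)
    (h : Tendsto (fun x => G (x + a) - G x - l * log x) atTop (𝓝 0)) :
    Tendsto (fun x => G (x + s) - G x - s / a * l * log x) atTop (𝓝 0) := by
  rcases lt_trichotomy s 0 with hs | rfl | hs
  · have h1 := (hG.tendsto_add_sub_sub_log_of_pos ha (neg_pos.2 hs) h).comp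
      (tendsto_atTop_add_const_right atTop s tendsto_id)
    have h2 := h1.neg.add ((Real.tendsto_log_comp_add_sub_log s).const_mul (s / a * l))
    simp only [neg_zero, mul_zero, add_zero] at h2
    refine h2.congr fun x => ?_
    simp only [Function.comp_apply, id, add_neg_cancel_right]
    ring
  · simp
  · exact hG.tendsto_add_sub_sub_log_of_pos ha hs h

lemma Real.tendsto_log_Gamma_add_sub (t : ℝ) :
    Tendsto (fun x => log (Gamma (x + t)) - log (Gamma x) - t * log x) atTop (𝓝 0) := by
  have := Real.convexOn_log_Gamma.tendsto_add_sub_sub_log (a := 1) (l := 1) one_pos t (by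
    refine tendsto_const_nhds.congr' ?_
    filter_upwards [eventually_gt_atTop 0] with x hx
    simp only [Function.comp_apply]
    rw [Real.Gamma_add_one hx.ne', log_mul hx.ne' (Gamma_pos_of_pos hx).ne']
    ring)
  simpa using this

end Asymptotics

/-- A Bohr–Mollerup type theorem: a log-convex function `M` with `M 0 = 1` and
`M (s + a) = Γ(s + m) / Γ(s + a) * M s` is the limit of the Beta-type partial products. -/
theorem tendsto_beta_product_of_log_convex {a m : ℝ} (ha : 0 < a) (hm : a < m) {M : ℝ → ℝ}
    (hpos : ∀ s, -a < s → 0 < M s) (h0 : M 0 = 1)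
    (hrec : ∀ s, -a < s → M (s + a) = Gamma (s + m) / Gamma (s + a) * M s)
    (hconv : ConvexOn ℝ (Ioi (-a)) fun s => log (M s)) {s : ℝ} (hs : -a < s) :
    Tendsto
      (fun N : ℕ =>
        (a ^ ((m - a) / a) * Gamma (m / a)) ^ s *
          ∏ n ∈ Finset.range (N + 1),
            (((m + a * n) / (a + a * n)) ^ s *
              (Gamma (a + a * n + s) * Gamma (m + a * n) /
                (Gamma (a + a * n) * Gamma (m + a * n + s)))))
      atTop (𝓝 (M s)) := by
  have hm0 : 0 < m := ha.trans hm
  have hma : 0 < m / a := div_pos hm0 ha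
  have hC : 0 < a ^ ((m - a) / a) * Gamma (m / a) :=
    mul_pos (rpow_pos_of_pos ha _) (Gamma_pos_of_pos hma)
  have hlogrec (t : ℝ) (ht : -a < t) :
      log (M (t + a)) = log (Gamma (t + m)) - log (Gamma (t + a)) + log (M t) := by
    have h1 := Gamma_pos_of_pos (show 0 < t + m by linarith)
    have h2 := Gamma_pos_of_pos (show 0 < t + a by linarith)
    rw [hrec t ht, log_mul (div_pos h1 h2).ne' (hpos t ht).ne', log_div h1.ne' h2.ne']
  have hincr : Tendsto (fun x => log (M (x + a)) - log (M x) - (m - a) * log x) atTop (𝓝 0) := by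
    have := (Real.tendsto_log_Gamma_add_sub m).sub (Real.tendsto_log_Gamma_add_sub a)
    rw [sub_zero] at this
    refine this.congr' ?_
    filter_upwards [eventually_gt_atTop (-a)] with x hx
    rw [hlogrec x hx]
    ring
  have hM := hconv.tendsto_add_sub_sub_log ha s hincr
  have hG := Real.tendsto_log_Gamma_add_sub (m / a - 1)
  have hcast : Tendsto (fun n : ℕ => (n : ℝ) + 1) atTop atTop :=
    tendsto_atTop_add_const_right _ _ tendsto_natCast_atTop_atTop
  have hpartial (n : ℕ) :
      (a ^ ((m - a) / a) * Gamma (m / a)) ^ s *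
          ∏ k ∈ Finset.range n,
            (((m + a * k) / (a + a * k)) ^ s *
              (Gamma (a + a * k + s) * Gamma (m + a * k) /
                (Gamma (a + a * k) * Gamma (m + a * k + s)))) =
        M s * exp (s * ((m - a) / a * log a + log (Gamma (m / a + n)) - log (Gamma (1 + n))) -
          (log (M (a * n + s)) - log (M (a * n)))) := by
    induction n with
    | zero =>
      rw [rpow_def_of_pos hC, log_mul (rpow_pos_of_pos ha _).ne' (Gamma_pos_of_pos hma).ne',
        log_rpow ha]
      nth_rewrite 1 [← exp_log (hpos s hs)]
      rw [Finset.prod_range_zero, mul_one, ← exp_add]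
      simp [h0]
      ring
    | succ n ih =>
      have hn : (0 : ℝ) ≤ a * n := by positivity
      have p1 : 0 < (m + a * n) / (a + a * n) := by positivity
      have p2 := Gamma_pos_of_pos (show 0 < a + a * n + s by linarith)
      have p3 := Gamma_pos_of_pos (show 0 < m + a * n by linarith)
      have p4 := Gamma_pos_of_pos (show 0 < a + a * n by linarith)
      have p5 := Gamma_pos_of_pos (show 0 < m + a * n + s by linarith)
      have q1 : log ((m + a * n) / (a + a * n)) = log (m / a + n) - log (1 + n) := by
        rw [← log_div (by positivity) (by positivity)]
        congr 1
        field_simp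
      have q2 : log (Gamma (m / a + (n + 1))) = log (m / a + n) + log (Gamma (m / a + n)) := by
        have : 0 < m / a + n := by positivity
        rw [← add_assoc, Real.Gamma_add_one this.ne', log_mul this.ne' (Gamma_pos_of_pos this).ne']
      have q3 : log (Gamma (1 + ((n : ℝ) + 1))) = log (1 + n) + log (Gamma (1 + (n : ℝ))) := by
        have : 0 < 1 + (n : ℝ) := by positivity
        rw [← add_assoc, Real.Gamma_add_one this.ne', log_mul this.ne' (Gamma_pos_of_pos this).ne']
      have q4 := hlogrec (a * n + s) (by linarith)
      have q5 := hlogrec (a * n) (by linarith)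
      rw [Finset.prod_range_succ, ← mul_assoc, ih, rpow_def_of_pos p1,
        ← exp_log (div_pos (mul_pos p2 p3) (mul_pos p4 p5)), ← exp_add, mul_assoc, ← exp_add,
        log_div (mul_pos p2 p3).ne' (mul_pos p4 p5).ne', log_mul p2.ne' p3.ne',
        log_mul p4.ne' p5.ne', q1]
      push_cast
      rw [q2, q3, show a * ((n : ℝ) + 1) + s = a * n + s + a by ring,
        show a * ((n : ℝ) + 1) = a * n + a by ring, q4, q5,
        show a * (n : ℝ) + s + m = m + a * n + s by ring,
        show a * (n : ℝ) + s + a = a + a * n + s by ring,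
        show a * (n : ℝ) + m = m + a * n by ring, show a * (n : ℝ) + a = a + a * n by ring]
      congr 2
      ring
  have hlim : Tendsto (fun n : ℕ => M s *
      exp (s * ((m - a) / a * log a + log (Gamma (m / a + n)) - log (Gamma (1 + n))) -
          (log (M (a * n + s)) - log (M (a * n))))) atTop (𝓝 (M s)) := by
    have hlog1 := (Real.tendsto_log_comp_add_sub_log 1).comp tendsto_natCast_atTop_atTop
    have h1 := (((hG.comp hcast).add (hlog1.const_mul (m / a - 1))).const_mul s).sub
      (hM.comp (tendsto_natCast_atTop_atTop.const_mul_atTop ha))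
    simp only [mul_zero, add_zero, sub_zero] at h1
    have h2 := ((continuous_exp.tendsto 0).comp h1).const_mul (M s)
    rw [exp_zero, mul_one] at h2
    refine h2.congr' ?_
    filter_upwards [eventually_gt_atTop 0] with n hn
    have hn' : (0 : ℝ) < n := Nat.cast_pos.2 hn
    simp only [Function.comp_apply]
    rw [log_mul ha.ne' hn'.ne', show (n : ℝ) + 1 + (m / a - 1) = m / a + n by ring,
      add_comm (n : ℝ) 1, sub_div m a a, div_self ha.ne',
      show s / a * (m - a) = s * (m / a - 1) by field_simp]
    congr 2
    ring
  simp only [hpartial]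
  exact hlim.comp (tendsto_add_atTop_nat 1)

section Tonelli

lemma lintegral_Ioi_mul_lintegral_Ioo_sub {w k g : ℝ → ℝ≥0∞} (hw : Measurable w)
    (hk : Measurable k) (hg : Measurable g) :
    ∫⁻ x in Ioi (0 : ℝ), w x * ∫⁻ v in Ioo (0 : ℝ) x, k (x - v) * g v =
      ∫⁻ v in Ioi (0 : ℝ), g v * ∫⁻ t in Ioi (0 : ℝ), w (v + t) * k t := by
  set S : Set (ℝ × ℝ) := {p | 0 < p.2 ∧ p.2 < p.1} with hS
  have hSm : MeasurableSet S :=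
    (measurableSet_lt measurable_const measurable_snd).inter
      (measurableSet_lt measurable_snd measurable_fst)
  set H : ℝ × ℝ → ℝ≥0∞ := S.indicator fun p => w p.1 * (k (p.1 - p.2) * g p.2) with hH
  have hHm : Measurable H := Measurable.indicator (by fun_prop) hSm
  have hleft : ∫⁻ x in Ioi (0 : ℝ), w x * ∫⁻ v in Ioo (0 : ℝ) x, k (x - v) * g v =
      ∫⁻ x, ∫⁻ v, H (x, v) := by
    rw [← lintegral_indicator measurableSet_Ioi]
    refine lintegral_congr fun x => ?_
    by_cases hx : 0 < x
    · rw [indicator_of_mem (mem_Ioi.2 hx), ← lintegral_const_mul _ (by fun_prop),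
        ← lintegral_indicator measurableSet_Ioo]
      refine lintegral_congr fun v => ?_
      simp only [hH, hS, indicator, mem_Ioo, mem_ofPred_eq]
    · rw [indicator_of_notMem (by simpa using hx)]
      refine (lintegral_eq_zero_of_ae_eq_zero (Eventually.of_forall fun v => ?_)).symm
      exact indicator_of_notMem (fun h => hx (h.1.trans h.2)) _
  have hright : ∫⁻ v in Ioi (0 : ℝ), g v * ∫⁻ t in Ioi (0 : ℝ), w (v + t) * k t =
      ∫⁻ v, ∫⁻ x, H (x, v) := by
    rw [← lintegral_indicator measurableSet_Ioi]
    refine lintegral_congr fun v => ?_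
    rw [← lintegral_add_left_eq_self _ v]
    by_cases hv : 0 < v
    · rw [indicator_of_mem (mem_Ioi.2 hv), ← lintegral_const_mul _ (by fun_prop),
        ← lintegral_indicator measurableSet_Ioi]
      refine lintegral_congr fun t => ?_
      simp only [hH, hS, indicator, mem_Ioi, mem_ofPred_eq, hv, true_and, lt_add_iff_pos_right,
        add_sub_cancel_left]
      split_ifs
      · ring
      · rfl
    · rw [indicator_of_notMem (by simpa using hv)]
      refine (lintegral_eq_zero_of_ae_eq_zero (Eventually.of_forall fun t => ?_)).symm
      exact indicator_of_notMem (fun h => hv h.1) _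
  rw [hleft, hright]
  exact lintegral_lintegral_swap hHm.aemeasurable

lemma lintegral_rpow_mul_exp_neg_mul_Ioi {p r : ℝ} (hp : 0 < p) (hr : 0 < r) :
    ∫⁻ t in Ioi (0 : ℝ), ENNReal.ofReal (t ^ (p - 1) * exp (-(r * t))) =
      ENNReal.ofReal (r ^ (-p) * Gamma p) := by
  have h := Real.integral_rpow_mul_exp_neg_mul_Ioi hp hr
  have hpos : 0 < (1 / r) ^ p * Gamma p :=
    mul_pos (rpow_pos_of_pos (one_div_pos.2 hr) _) (Gamma_pos_of_pos hp)
  rw [← ofReal_integral_eq_lintegral_ofReal (Integrable.of_integral_ne_zero (h ▸ hpos.ne')), h,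
    one_div, inv_rpow hr.le, rpow_neg hr.le]
  filter_upwards [ae_restrict_mem measurableSet_Ioi] with t ht
  have : (0 : ℝ) < t := ht
  positivity

lemma lintegral_add_rpow_mul_rpow_Ioi {α q v : ℝ} (hα : 0 < α) (hq : α < q) (hv : 0 < v) :
    ∫⁻ t in Ioi (0 : ℝ), ENNReal.ofReal ((v + t) ^ (-q)) * ENNReal.ofReal (t ^ (α - 1)) =
      ENNReal.ofReal (Gamma α * Gamma (q - α) / Gamma q * v ^ (α - q)) := by
  have hq0 : 0 < q := hα.trans hq
  have hΓq := Gamma_pos_of_pos hq0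
  have hΓα := Gamma_pos_of_pos hα
  have hΓ := Gamma_pos_of_pos (sub_pos.2 hq)
  have h1 : ∫⁻ t in Ioi (0 : ℝ), ENNReal.ofReal ((v + t) ^ (-q)) * ENNReal.ofReal (t ^ (α - 1)) =
      ∫⁻ t in Ioi (0 : ℝ), ∫⁻ y in Ioi (0 : ℝ), ENNReal.ofReal
        (t ^ (α - 1) * (1 / Gamma q) * (y ^ (q - 1) * exp (-((v + t) * y)))) := by
    refine setLIntegral_congr_fun measurableSet_Ioi fun t ht => ?_
    have ht : (0 : ℝ) < t := ht
    have hc : 0 ≤ t ^ (α - 1) * (1 / Gamma q) := by positivity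
    simp only [ENNReal.ofReal_mul hc]
    rw [lintegral_const_mul _ (by fun_prop), lintegral_rpow_mul_exp_neg_mul_Ioi hq0 (by positivity),
      ← ENNReal.ofReal_mul hc, ← ENNReal.ofReal_mul (by positivity)]
    congr 1
    field_simp
  have h2 : ∫⁻ y in Ioi (0 : ℝ), ∫⁻ t in Ioi (0 : ℝ), ENNReal.ofReal
        (t ^ (α - 1) * (1 / Gamma q) * (y ^ (q - 1) * exp (-((v + t) * y)))) =
      ∫⁻ y in Ioi (0 : ℝ), ENNReal.ofReal (Gamma α / Gamma q) *
        ENNReal.ofReal (y ^ (q - α - 1) * exp (-(v * y))) := by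
    refine setLIntegral_congr_fun measurableSet_Ioi fun y hy => ?_
    have hy : (0 : ℝ) < y := hy
    have hc : 0 ≤ 1 / Gamma q * y ^ (q - 1) * exp (-(v * y)) := by positivity
    have (t : ℝ) : t ^ (α - 1) * (1 / Gamma q) * (y ^ (q - 1) * exp (-((v + t) * y))) =
        1 / Gamma q * y ^ (q - 1) * exp (-(v * y)) * (t ^ (α - 1) * exp (-(y * t))) := by
      rw [show -((v + t) * y) = -(v * y) + -(y * t) by ring, exp_add]
      ring
    simp only [this, ENNReal.ofReal_mul hc]
    rw [lintegral_const_mul _ (by fun_prop), lintegral_rpow_mul_exp_neg_mul_Ioi hα hy,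
      ← ENNReal.ofReal_mul hc, ← ENNReal.ofReal_mul (by positivity),
      show q - α - 1 = (q - 1) + -α by ring, rpow_add hy]
    congr 1
    ring
  rw [h1, lintegral_lintegral_swap (by fun_prop), h2, lintegral_const_mul _ (by fun_prop),
    lintegral_rpow_mul_exp_neg_mul_Ioi (sub_pos.2 hq) hv, ← ENNReal.ofReal_mul (by positivity),
    neg_sub]
  congr 1
  ring

end Tonelli

/-- The Mellin transform `∫ x^{-s} g(x) dx` on `(0,∞)` with values in `[0,∞]`. -/
def lmellin (g : ℝ → ℝ≥0∞) (s : ℝ) : ℝ≥0∞ :=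
  ∫⁻ x in Ioi (0 : ℝ), ENNReal.ofReal (x ^ (-s)) * g x

section Mellin

variable {g : ℝ → ℝ≥0∞}

lemma lmellin_zero (g : ℝ → ℝ≥0∞) : lmellin g 0 = ∫⁻ x in Ioi (0 : ℝ), g x := by
  simp [lmellin]

lemma lmellin_convex_comb_le (hg : Measurable g) (s t : ℝ) {p q : ℝ} (hp : 0 ≤ p) (hq : 0 ≤ q)
    (hpq : p + q = 1) :
    lmellin g (p * s + q * t) ≤ lmellin g s ^ p * lmellin g t ^ q := by
  refine le_trans (le_of_eq ?_) (ENNReal.lintegral_mul_norm_pow_le (by fun_prop) (by fun_prop)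
    hp hq hpq)
  refine setLIntegral_congr_fun measurableSet_Ioi fun x hx => ?_
  have hx : (0 : ℝ) < x := hx
  have hg1 : g x = g x ^ p * g x ^ q := by
    rw [← ENNReal.rpow_add_of_nonneg _ _ hp hq, hpq, ENNReal.rpow_one]
  rw [ENNReal.mul_rpow_of_nonneg _ _ hp, ENNReal.mul_rpow_of_nonneg _ _ hq,
    ENNReal.ofReal_rpow_of_pos (by positivity), ENNReal.ofReal_rpow_of_pos (by positivity),
    mul_mul_mul_comm, ← hg1, ← ENNReal.ofReal_mul (by positivity), ← rpow_mul hx.le,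
    ← rpow_mul hx.le, ← rpow_add hx]
  congr 3
  ring

lemma lmellin_pos (hg : Measurable g) (h0 : lmellin g 0 ≠ 0) (s : ℝ) : 0 < lmellin g s := by
  refine pos_iff_ne_zero.2 fun h => h0 ?_
  rw [lmellin, lintegral_eq_zero_iff (by fun_prop)] at h
  rw [lmellin_zero, lintegral_eq_zero_iff hg]
  filter_upwards [h, ae_restrict_mem measurableSet_Ioi] with x hx hx0
  have hx0 : (0 : ℝ) < x := hx0
  simpa [(rpow_pos_of_pos hx0 (-s)).not_ge] using hx

lemma convexOn_log_lmellin (hg : Measurable g) {c : ℝ} (h0 : lmellin g 0 ≠ 0)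
    (hfin : ∀ s, c < s → lmellin g s ≠ ∞) :
    ConvexOn ℝ (Ioi c) fun s => log (lmellin g s).toReal := by
  refine ⟨convex_Ioi c, fun s hs t ht p q hp hq hpq => ?_⟩
  have hst : c < p * s + q * t := convex_Ioi c hs ht hp hq hpq
  have hpos (u : ℝ) (hu : c < u) : 0 < (lmellin g u).toReal :=
    ENNReal.toReal_pos (lmellin_pos hg h0 u).ne' (hfin u hu)
  have hle := ENNReal.toReal_mono
    (ENNReal.mul_ne_top (ENNReal.rpow_ne_top_of_nonneg hp (hfin s hs))
      (ENNReal.rpow_ne_top_of_nonneg hq (hfin t ht))) (lmellin_convex_comb_le hg s t hp hq hpq)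
  rw [ENNReal.toReal_mul, ← ENNReal.toReal_rpow, ← ENNReal.toReal_rpow] at hle
  have hs' := hpos s hs
  have ht' := hpos t ht
  simp only [smul_eq_mul]
  rw [← log_rpow hs', ← log_rpow ht',
    ← log_mul (rpow_pos_of_pos hs' _).ne' (rpow_pos_of_pos ht' _).ne']
  exact log_le_log (hpos _ hst) hle

/-- The Mellin transform of a solution satisfies a Gamma-type recursion. -/
lemma lmellin_add_of_fractional_eq {α m s : ℝ} (hα : 0 < α) (hs : α - m < s) (hg : Measurable g)
    (h : ∀ᵐ x ∂volume.restrict (Ioi (0 : ℝ)), ENNReal.ofReal (x ^ m) * g x =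
      ENNReal.ofReal (1 / Gamma α) *
        ∫⁻ v in Ioo (0 : ℝ) x, ENNReal.ofReal ((x - v) ^ (α - 1)) * g v) :
    lmellin g s =
      ENNReal.ofReal (Gamma (s + (m - α)) / Gamma (s + m)) * lmellin g (s + (m - α)) := by
  have hΓα := Gamma_pos_of_pos hα
  have hΓ1 := Gamma_pos_of_pos (show 0 < s + (m - α) by linarith)
  have hΓ2 := Gamma_pos_of_pos (show 0 < s + m by linarith)
  have h1 : lmellin g s = ENNReal.ofReal (1 / Gamma α) *
      ∫⁻ x in Ioi (0 : ℝ), ENNReal.ofReal (x ^ (-(s + m))) *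
        ∫⁻ v in Ioo (0 : ℝ) x, ENNReal.ofReal ((x - v) ^ (α - 1)) * g v := by
    rw [← lintegral_const_mul' _ _ ENNReal.ofReal_ne_top]
    refine lintegral_congr_ae ?_
    filter_upwards [h, ae_restrict_mem measurableSet_Ioi] with x hx hx0
    have hx0 : (0 : ℝ) < x := hx0
    rw [mul_left_comm, ← hx, ← mul_assoc, ← ENNReal.ofReal_mul (by positivity), ← rpow_add hx0]
    congr 3
    ring
  rw [h1, lintegral_Ioi_mul_lintegral_Ioo_sub (w := fun x => ENNReal.ofReal (x ^ (-(s + m))))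
    (k := fun t => ENNReal.ofReal (t ^ (α - 1))) (by fun_prop) (by fun_prop) hg, lmellin,
    ← lintegral_const_mul' _ _ ENNReal.ofReal_ne_top,
    ← lintegral_const_mul' _ _ ENNReal.ofReal_ne_top]
  refine setLIntegral_congr_fun measurableSet_Ioi fun v hv => ?_
  have hv : (0 : ℝ) < v := hv
  rw [lintegral_add_rpow_mul_rpow_Ioi hα (by linarith) hv, mul_left_comm,
    ← ENNReal.ofReal_mul (by positivity), ← mul_assoc (ENNReal.ofReal _) (ENNReal.ofReal _),
    ← ENNReal.ofReal_mul (by positivity), mul_comm, show s + m - α = s + (m - α) by ring,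
    show α - (s + m) = -(s + (m - α)) by ring]
  congr 2
  field_simp

lemma lmellin_ne_top {a m : ℝ} (ha : 0 < a) (hm : a < m) (hg : Measurable g)
    (h0 : lmellin g 0 ≠ ∞)
    (hrec : ∀ s, -a < s →
      lmellin g s = ENNReal.ofReal (Gamma (s + a) / Gamma (s + m)) * lmellin g (s + a))
    {s : ℝ} (hs : -a < s) : lmellin g s ≠ ∞ := by
  have hnat (n : ℕ) : lmellin g (a * n) ≠ ∞ := by
    induction n with
    | zero => simpa using h0
    | succ n ih =>
      have hn : 0 ≤ a * (n : ℝ) := by positivity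
      have hΓ : 0 < Gamma (a * n + a) / Gamma (a * n + m) :=
        div_pos (Gamma_pos_of_pos (by linarith)) (Gamma_pos_of_pos (by linarith))
      intro h
      apply ih
      rw [hrec _ (by linarith), show a * (n : ℝ) + a = a * (n + 1 : ℕ) by push_cast; ring, h]
      refine ENNReal.mul_top ?_
      rw [show a * ((n + 1 : ℕ) : ℝ) = a * (n : ℝ) + a by push_cast; ring]
      simpa using hΓ
  have hnonneg (s : ℝ) (hs : 0 ≤ s) : lmellin g s ≠ ∞ := by
    obtain ⟨n, hn⟩ := exists_nat_gt (s / a)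
    rw [div_lt_iff₀ ha] at hn
    have hn0 : 0 < a * (n : ℝ) := by linarith
    have hq : 0 ≤ s / (a * n) := by positivity
    have hp : 0 ≤ 1 - s / (a * n) := by
      rw [sub_nonneg, div_le_one hn0]
      linarith
    have := lmellin_convex_comb_le hg 0 (a * n) hp hq (by ring)
    rw [mul_zero, zero_add, div_mul_cancel₀ _ hn0.ne'] at this
    exact ne_top_of_le_ne_top (ENNReal.mul_ne_top (ENNReal.rpow_ne_top_of_nonneg hp h0)
      (ENNReal.rpow_ne_top_of_nonneg hq (hnat n))) this
  rw [hrec s hs]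
  exact ENNReal.mul_ne_top ENNReal.ofReal_ne_top (hnonneg _ (by linarith))

end Mellin

namespace IsDensitySolution

variable {α m : ℝ} {f : ℝ → ℝ}

lemma ae_nonneg (hf : IsDensitySolution α m f) : 0 ≤ᵐ[volume.restrict (Ioi (0 : ℝ))] f := by
  filter_upwards [ae_restrict_mem measurableSet_Ioi] with x hx using hf.2.1 x hx

lemma lmellin_zero (hf : IsDensitySolution α m f) :
    lmellin (fun x => ENNReal.ofReal (f x)) 0 = 1 := by
  have hint : IntegrableOn f (Ioi 0) := Integrable.of_integral_ne_zero (by rw [hf.2.2.1]; simp)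
  rw [_root_.lmellin_zero, ← ofReal_integral_eq_lintegral_ofReal hint hf.ae_nonneg, hf.2.2.1,
    ENNReal.ofReal_one]

/-- The fractional integral of an integrable density is finite almost everywhere. -/
lemma ae_fractional_lt_top (hα : 0 < α) (hf : IsDensitySolution α m f) :
    ∀ᵐ x ∂volume.restrict (Ioi (0 : ℝ)),
      ∫⁻ v in Ioo (0 : ℝ) x, ENNReal.ofReal ((x - v) ^ (α - 1)) * ENNReal.ofReal (f v) < ∞ := by
  have hfm : Measurable f := hf.1
  have h := lintegral_Ioi_mul_lintegral_Ioo_sub (w := fun x => ENNReal.ofReal (exp (-x)))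
    (k := fun t => ENNReal.ofReal (t ^ (α - 1))) (g := fun x => ENNReal.ofReal (f x))
    (by fun_prop) (by fun_prop) (by fun_prop)
  have hlt : ∫⁻ v in Ioi (0 : ℝ), ENNReal.ofReal (f v) * ∫⁻ t in Ioi (0 : ℝ),
      ENNReal.ofReal (exp (-(v + t))) * ENNReal.ofReal (t ^ (α - 1)) < ∞ := by
    have hle : ∫⁻ v in Ioi (0 : ℝ), ENNReal.ofReal (f v) * ∫⁻ t in Ioi (0 : ℝ),
        ENNReal.ofReal (exp (-(v + t))) * ENNReal.ofReal (t ^ (α - 1)) ≤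
        ∫⁻ v in Ioi (0 : ℝ), ENNReal.ofReal (f v) * ENNReal.ofReal (1 ^ (-α) * Gamma α) := by
      refine setLIntegral_mono (by fun_prop) fun v hv => ?_
      gcongr
      rw [← lintegral_rpow_mul_exp_neg_mul_Ioi hα one_pos]
      refine setLIntegral_mono (by fun_prop) fun t ht => ?_
      have hv : (0 : ℝ) < v := hv
      have ht : (0 : ℝ) < t := ht
      rw [← ENNReal.ofReal_mul (by positivity), mul_comm]
      gcongr
      linarith
    refine hle.trans_lt ?_
    rw [lintegral_mul_const _ (by fun_prop), ← _root_.lmellin_zero, hf.lmellin_zero, one_mul]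
    exact ENNReal.ofReal_lt_top
  rw [← h] at hlt
  have hmeas : Measurable fun x : ℝ =>
      ∫⁻ v in Ioo (0 : ℝ) x, ENNReal.ofReal ((x - v) ^ (α - 1)) * ENNReal.ofReal (f v) := by
    have hS : MeasurableSet {p : ℝ × ℝ | 0 < p.2 ∧ p.2 < p.1} :=
      (measurableSet_lt measurable_const measurable_snd).inter
        (measurableSet_lt measurable_snd measurable_fst)
    have hH : Measurable ({p : ℝ × ℝ | 0 < p.2 ∧ p.2 < p.1}.indicator fun p =>
        ENNReal.ofReal ((p.1 - p.2) ^ (α - 1)) * ENNReal.ofReal (f p.2)) :=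
      Measurable.indicator (by fun_prop) hS
    convert! hH.lintegral_prod_right' (ν := volume) using 2 with x
    rw [← lintegral_indicator measurableSet_Ioo]
    rfl
  filter_upwards [ae_lt_top (by fun_prop) hlt.ne] with x hx
  refine lt_top_iff_ne_top.2 fun hx' => ?_
  rw [hx', ENNReal.mul_top (by simp [exp_pos])] at hx
  exact lt_irrefl _ hx

lemma ae_fractional_eq (hα : 0 < α) (hf : IsDensitySolution α m f) :
    ∀ᵐ x ∂volume.restrict (Ioi (0 : ℝ)), ENNReal.ofReal (x ^ m) * ENNReal.ofReal (f x) =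
      ENNReal.ofReal (1 / Gamma α) *
        ∫⁻ v in Ioo (0 : ℝ) x, ENNReal.ofReal ((x - v) ^ (α - 1)) * ENNReal.ofReal (f v) := by
  have hfm : Measurable f := hf.1
  have hΓα := Gamma_pos_of_pos hα
  filter_upwards [hf.ae_fractional_lt_top hα, ae_restrict_mem measurableSet_Ioi] with x hx hx0
  have hnn (v : ℝ) (hv : v ∈ Ioo 0 x) : 0 ≤ (x - v) ^ (α - 1) :=
    rpow_nonneg (sub_nonneg.2 hv.2.le) _
  have heq : ∫⁻ v in Ioo (0 : ℝ) x, ENNReal.ofReal ((x - v) ^ (α - 1)) * ENNReal.ofReal (f v) =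
      ∫⁻ v in Ioo (0 : ℝ) x, ENNReal.ofReal ((x - v) ^ (α - 1) * f v) :=
    setLIntegral_congr_fun measurableSet_Ioo fun v hv => (ENNReal.ofReal_mul (hnn v hv)).symm
  have hnn' : 0 ≤ᵐ[volume.restrict (Ioo 0 x)] fun v => (x - v) ^ (α - 1) * f v := by
    filter_upwards [ae_restrict_mem measurableSet_Ioo] with v hv
      using mul_nonneg (hnn v hv) (hf.2.1 v hv.1)
  rw [heq] at hx ⊢
  have hint : Integrable (fun v => (x - v) ^ (α - 1) * f v) (volume.restrict (Ioo 0 x)) :=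
    ⟨by fun_prop, (hasFiniteIntegral_iff_ofReal hnn').2 hx⟩
  rw [← ofReal_integral_eq_lintegral_ofReal hint hnn',
    ← ENNReal.ofReal_mul (rpow_nonneg (le_of_lt hx0) _), ← ENNReal.ofReal_mul (by positivity),
    hf.2.2.2 x hx0]

end IsDensitySolution

/-- First Beta-product representation: for `s > −a` with `a = m − α`, the Mellin
transform of the density solution is finite and equals the limit of the partial
products `(a^{(m−a)/a} Γ(m/a))^s ∏_{n=0}^N ((m+an)/(a+an))^s
Γ(a+an+s)Γ(m+an)/(Γ(a+an)Γ(m+an+s))`. -/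
theorem mellin_first_product_representation (α m : ℝ) (hα : 0 < α) (hm : α < m)
    (a : ℝ) (ha : a = m - α)
    (f : ℝ → ℝ) (hf : IsDensitySolution α m f) :
    ∀ s : ℝ, -a < s →
      IntegrableOn (fun x : ℝ => x ^ (-s) * f x) (Set.Ioi (0:ℝ)) ∧
      Filter.Tendsto
        (fun N : ℕ =>
          (a ^ ((m - a) / a) * Real.Gamma (m / a)) ^ s *
            ∏ n ∈ Finset.range (N + 1),
              (((m + a * n) / (a + a * n)) ^ s *
                (Real.Gamma (a + a * n + s) * Real.Gamma (m + a * n) /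
                  (Real.Gamma (a + a * n) * Real.Gamma (m + a * n + s)))))
        Filter.atTop
        (nhds (∫ x in Set.Ioi (0:ℝ), x ^ (-s) * f x)) := by
  subst ha
  have ha : 0 < m - α := sub_pos.2 hm
  have hmα : m - α < m := sub_lt_self m hα
  have hfm : Measurable f := hf.1
  set g : ℝ → ℝ≥0∞ := fun x => ENNReal.ofReal (f x)
  have hg : Measurable g := by fun_prop
  have h0 : lmellin g 0 = 1 := hf.lmellin_zero
  have hrec (s : ℝ) (hs : -(m - α) < s) :=
    lmellin_add_of_fractional_eq hα (by linarith : α - m < s) hg (hf.ae_fractional_eq hα)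
  have hfin (s : ℝ) (hs : -(m - α) < s) : lmellin g s ≠ ∞ :=
    lmellin_ne_top ha hmα hg (by simp [h0]) hrec hs
  intro s hs
  have hnn : 0 ≤ᵐ[volume.restrict (Ioi (0 : ℝ))] fun x => x ^ (-s) * f x := by
    filter_upwards [ae_restrict_mem measurableSet_Ioi] with x hx
      using mul_nonneg (rpow_nonneg (le_of_lt hx) _) (hf.2.1 x hx)
  have hlm : ∫⁻ x in Ioi (0 : ℝ), ENNReal.ofReal (x ^ (-s) * f x) = lmellin g s :=
    setLIntegral_congr_fun measurableSet_Ioi fun x hx =>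
      ENNReal.ofReal_mul (rpow_nonneg (le_of_lt hx) _)
  refine ⟨⟨by fun_prop, ?_⟩, ?_⟩
  · rw [hasFiniteIntegral_iff_ofReal hnn, hlm]
    exact (hfin s hs).lt_top
  rw [integral_eq_lintegral_of_nonneg_ae hnn (by fun_prop), hlm]
  refine tendsto_beta_product_of_log_convex ha hmα (M := fun s => (lmellin g s).toReal)
    (fun t ht => ENNReal.toReal_pos (lmellin_pos hg (by simp [h0]) t).ne' (hfin t ht))
    (by simp [h0]) (fun t ht => ?_) (convexOn_log_lmellin hg (by simp [h0]) hfin) hs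
  have hΓ1 := Gamma_pos_of_pos (show 0 < t + (m - α) by linarith)
  have hΓ2 := Gamma_pos_of_pos (show 0 < t + m by linarith)
  rw [hrec t ht, ENNReal.toReal_mul, ENNReal.toReal_ofReal (by positivity)]
  field_simp
end
end

section
/- Let α > 0, m > α, and let f be the unique density solution to the equation x^m f(x) = (1/Γ(α)) ∫_0^x (x−v)^{α−1} f(v) dv on (0,∞). Then Γ(α) · x^{m+1−α} · f(x) tends to 1 as x → ∞; that is, f(x) ∼ x^{α−m−1}/Γ(α) as x → ∞. -/
open MeasureTheory Real Set Filter

noncomputable section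

/-- The Riemann–Liouville integral of order `b` at `x`, without its Gamma factor, as an
extended nonnegative real. -/
def lfracIntegral (b : ℝ) (F : ℝ → ENNReal) (x : ℝ) : ENNReal :=
  ∫⁻ v in Ioo (0:ℝ) x, ENNReal.ofReal ((x - v) ^ (b - 1)) * F v

theorem integrableOn_sub_rpow {b u x : ℝ} (hb : 0 < b) (hux : u ≤ x) :
    IntegrableOn (fun v => (x - v) ^ (b - 1)) (Ioo u x) := by
  have h := (intervalIntegral.intervalIntegrable_rpow' (a := 0) (b := x - u)
    (r := b - 1) (by linarith)).comp_sub_left x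
  simp only [sub_zero, sub_sub_cancel] at h
  exact ((intervalIntegrable_iff_integrableOn_Ioc_of_le hux).1 h.symm).mono_set Ioo_subset_Ioc_self

theorem integral_sub_rpow {b u x : ℝ} (hb : 0 < b) (hux : u ≤ x) :
    ∫ v in Ioo u x, (x - v) ^ (b - 1) = (x - u) ^ b / b := by
  rw [← integral_Ioc_eq_integral_Ioo, ← intervalIntegral.integral_of_le hux,
    intervalIntegral.integral_comp_sub_left (fun t => t ^ (b - 1)) x, sub_self,
    integral_rpow (Or.inl (by linarith))]
  simp [hb.ne']

theorem lintegral_sub_rpow_left {b u x : ℝ} (hb : 0 < b) (hux : u ≤ x) :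
    ∫⁻ v in Ioo u x, ENNReal.ofReal ((x - v) ^ (b - 1)) = ENNReal.ofReal ((x - u) ^ b / b) := by
  rw [← integral_sub_rpow hb hux, ofReal_integral_eq_lintegral_ofReal
    (integrableOn_sub_rpow hb hux)]
  filter_upwards [ae_restrict_mem measurableSet_Ioo] with v hv
  exact rpow_nonneg (by linarith [hv.2]) _

theorem lintegral_sub_rpow_right {b u x : ℝ} (hb : 0 < b) (hux : u ≤ x) :
    ∫⁻ v in Ioo u x, ENNReal.ofReal ((v - u) ^ (b - 1)) = ENNReal.ofReal ((x - u) ^ b / b) := by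
  have h := (Measure.measurePreserving_sub_left (volume : Measure ℝ) (u + x)).setLIntegral_comp_preimage_emb
    (MeasurableEquiv.subLeft (u + x)).measurableEmbedding
    (fun v => ENNReal.ofReal ((v - u) ^ (b - 1))) (Ioo u x)
  rw [← h, ← lintegral_sub_rpow_left hb hux]
  simp only [preimage_const_sub_Ioo, add_sub_cancel_left, add_sub_cancel_right]
  congr 1
  ext v
  congr 2
  ring

/-- A bound of the right order for the Beta integral over `(u, x)`. -/
theorem lintegral_sub_rpow_mul_sub_rpow_le {a b u x : ℝ} (ha : 0 < a) (ha1 : a ≤ 1) (hb : 0 < b)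
    (hb1 : b ≤ 1) (hux : u < x) :
    ∫⁻ v in Ioo u x, ENNReal.ofReal ((x - v) ^ (b - 1)) * ENNReal.ofReal ((v - u) ^ (a - 1)) ≤
      ENNReal.ofReal (2 ^ (1 - b) / a + 2 ^ (1 - a) / b) *
        ENNReal.ofReal ((x - u) ^ (a + b - 1)) := by
  have hL : 0 < x - u := by linarith
  have key : ∀ v ∈ Ioo u x,
      ENNReal.ofReal ((x - v) ^ (b - 1)) * ENNReal.ofReal ((v - u) ^ (a - 1)) ≤
        ENNReal.ofReal (((x - u) / 2) ^ (b - 1)) * ENNReal.ofReal ((v - u) ^ (a - 1)) +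
        ENNReal.ofReal (((x - u) / 2) ^ (a - 1)) * ENNReal.ofReal ((x - v) ^ (b - 1)) := by
    intro v hv
    rcases le_total v ((u + x) / 2) with h | h
    · refine le_trans ?_ le_self_add
      gcongr ENNReal.ofReal ?_ * _
      exact rpow_le_rpow_of_nonpos (by linarith) (by linarith) (by linarith)
    · refine le_trans ?_ le_add_self
      rw [mul_comm]
      gcongr ENNReal.ofReal ?_ * _
      exact rpow_le_rpow_of_nonpos (by linarith) (by linarith) (by linarith)
  refine (setLIntegral_mono' measurableSet_Ioo key).trans (le_of_eq ?_)
  rw [lintegral_add_left (by fun_prop), lintegral_const_mul' _ _ ENNReal.ofReal_ne_top,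
    lintegral_const_mul' _ _ ENNReal.ofReal_ne_top, lintegral_sub_rpow_left hb hux.le,
    lintegral_sub_rpow_right ha hux.le, ← ENNReal.ofReal_mul (by positivity),
    ← ENNReal.ofReal_mul (by positivity), ← ENNReal.ofReal_mul (by positivity),
    ← ENNReal.ofReal_add (by positivity) (by positivity)]
  congr 1
  have e : ∀ c : ℝ, ((x - u) / 2) ^ (c - 1) = (x - u) ^ (c - 1) * 2 ^ (1 - c) := fun c => by
    rw [div_rpow hL.le zero_le_two, div_eq_mul_inv, ← rpow_neg zero_le_two, neg_sub]
  have e1 : (x - u) ^ (a + b - 1) = (x - u) ^ (b - 1) * (x - u) ^ a := by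
    rw [← rpow_add hL]; ring_nf
  have e2 : (x - u) ^ (a + b - 1) = (x - u) ^ (a - 1) * (x - u) ^ b := by
    rw [← rpow_add hL]; ring_nf
  rw [e, e, add_mul]
  nth_rewrite 1 [e1]
  rw [e2]
  ring

theorem lfracIntegral_le_of_one_le {b x : ℝ} {F : ℝ → ENNReal} (hb : 1 ≤ b)
    (hF : ∫⁻ v in Ioi (0:ℝ), F v = 1) : lfracIntegral b F x ≤ ENNReal.ofReal (x ^ (b - 1)) := by
  calc lfracIntegral b F x ≤ ∫⁻ v in Ioo (0:ℝ) x, ENNReal.ofReal (x ^ (b - 1)) * F v := by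
        refine setLIntegral_mono' measurableSet_Ioo fun v hv => ?_
        gcongr ENNReal.ofReal ?_ * _
        exact rpow_le_rpow (by linarith [hv.2]) (by linarith [hv.1]) (by linarith)
    _ = ENNReal.ofReal (x ^ (b - 1)) * ∫⁻ v in Ioo (0:ℝ) x, F v :=
        lintegral_const_mul' _ _ ENNReal.ofReal_ne_top
    _ ≤ ENNReal.ofReal (x ^ (b - 1)) * ∫⁻ v in Ioi (0:ℝ), F v := by
        gcongr
        exact Ioo_subset_Ioi_self
    _ = _ := by rw [hF, mul_one]

/-- Semigroup property of fractional integration, as an inequality up to a constant. -/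
theorem lfracIntegral_lfracIntegral_le {a b x : ℝ} {F : ℝ → ENNReal} (hFm : Measurable F)
    (ha : 0 < a) (ha1 : a ≤ 1) (hb : 0 < b) (hb1 : b ≤ 1) :
    lfracIntegral b (lfracIntegral a F) x ≤
      ENNReal.ofReal (2 ^ (1 - b) / a + 2 ^ (1 - a) / b) * lfracIntegral (a + b) F x := by
  let G : ℝ → ℝ → ENNReal := fun v u =>
    (Iio v).indicator (fun u => ENNReal.ofReal ((x - v) ^ (b - 1)) *
      (ENNReal.ofReal ((v - u) ^ (a - 1)) * F u)) u
  have hG : Measurable (Function.uncurry G) := by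
    have : Function.uncurry G = {p : ℝ × ℝ | p.2 < p.1}.indicator
        (fun p => ENNReal.ofReal ((x - p.1) ^ (b - 1)) *
          (ENNReal.ofReal ((p.1 - p.2) ^ (a - 1)) * F p.2)) := by
      ext p
      simp [G, Function.uncurry, indicator]
    rw [this]
    exact Measurable.indicator (by fun_prop) (measurableSet_lt measurable_snd measurable_fst)
  have h1 : lfracIntegral b (lfracIntegral a F) x =
      ∫⁻ v in Ioo (0:ℝ) x, ∫⁻ u in Ioo (0:ℝ) x, G v u := by
    refine setLIntegral_congr_fun measurableSet_Ioo fun v hv => ?_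
    simp only [G]
    rw [lintegral_indicator measurableSet_Iio, Measure.restrict_restrict measurableSet_Iio,
      lintegral_const_mul' _ _ ENNReal.ofReal_ne_top, lfracIntegral]
    congr 3
    ext u
    simp only [mem_Ioo, mem_inter_iff, mem_Iio]
    exact ⟨fun h => ⟨h.2, h.1, h.2.trans hv.2⟩, fun h => ⟨h.2.1, h.1⟩⟩
  rw [h1, lintegral_lintegral_swap hG.aemeasurable, lfracIntegral,
    ← lintegral_const_mul' _ _ ENNReal.ofReal_ne_top]
  refine setLIntegral_mono' measurableSet_Ioo fun u hu => ?_
  have h2 : ∫⁻ v in Ioo (0:ℝ) x, G v u =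
      (∫⁻ v in Ioo u x, ENNReal.ofReal ((x - v) ^ (b - 1)) *
        ENNReal.ofReal ((v - u) ^ (a - 1))) * F u := by
    rw [← lintegral_mul_const _ (by fun_prop)]
    have : (fun v => G v u) = (Ioi u).indicator (fun v => ENNReal.ofReal ((x - v) ^ (b - 1)) *
        ENNReal.ofReal ((v - u) ^ (a - 1)) * F u) := by
      ext v
      simp [G, indicator, mul_assoc]
    rw [this, lintegral_indicator measurableSet_Ioi, Measure.restrict_restrict measurableSet_Ioi]
    congr 2
    ext v
    simp only [mem_Ioo, mem_inter_iff, mem_Ioi]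
    exact ⟨fun h => ⟨h.1, h.2.2⟩, fun h => ⟨h.1, hu.1.trans h.1, h.2⟩⟩
  rw [h2, ← mul_assoc]
  gcongr
  exact lintegral_sub_rpow_mul_sub_rpow_le ha ha1 hb hb1 hu.2

/-- One bootstrapping step: a subsolution has its fractional integral of order `b` controlled by
the one of order `a + b`. -/
theorem lfracIntegral_le_add {a b m c x : ℝ} {F : ℝ → ENNReal} (hFm : Measurable F)
    (hF : ∫⁻ v in Ioi (0:ℝ), F v = 1) (ha : 0 < a) (ha1 : a ≤ 1) (hb : 0 < b) (hb1 : b ≤ 1)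
    (hm : 0 ≤ m) (hc : 0 ≤ c)
    (hsub : ∀ x, 0 < x → F x ≤ ENNReal.ofReal (c * x ^ (-m)) * lfracIntegral a F x)
    (hx : 0 < x) :
    lfracIntegral b F x ≤ ENNReal.ofReal ((x / 2) ^ (b - 1)) +
      ENNReal.ofReal (c * (x / 2) ^ (-m)) *
        (ENNReal.ofReal (2 ^ (1 - b) / a + 2 ^ (1 - a) / b) * lfracIntegral (a + b) F x) := by
  have key : ∀ v ∈ Ioo (0:ℝ) x, ENNReal.ofReal ((x - v) ^ (b - 1)) * F v ≤
      ENNReal.ofReal ((x / 2) ^ (b - 1)) * F v + ENNReal.ofReal (c * (x / 2) ^ (-m)) *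
        (ENNReal.ofReal ((x - v) ^ (b - 1)) * lfracIntegral a F v) := by
    intro v hv
    rcases le_total v (x / 2) with h | h
    · refine le_trans ?_ le_self_add
      gcongr ENNReal.ofReal ?_ * _
      exact rpow_le_rpow_of_nonpos (by linarith) (by linarith) (by linarith)
    · refine le_trans ?_ le_add_self
      rw [mul_left_comm]
      gcongr
      refine (hsub v hv.1).trans ?_
      gcongr ENNReal.ofReal (c * ?_) * _
      exact rpow_le_rpow_of_nonpos (by linarith) (by linarith) (by linarith)
  refine (setLIntegral_mono' measurableSet_Ioo key).trans ?_
  rw [lintegral_add_left (by fun_prop), lintegral_const_mul' _ _ ENNReal.ofReal_ne_top,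
    lintegral_const_mul' _ _ ENNReal.ofReal_ne_top]
  gcongr
  · calc _ ≤ ENNReal.ofReal ((x / 2) ^ (b - 1)) * ∫⁻ v in Ioi (0:ℝ), F v := by
          gcongr
          exact Ioo_subset_Ioi_self
      _ = _ := by rw [hF, mul_one]
  · exact lfracIntegral_lfracIntegral_le hFm ha ha1 hb hb1

theorem exists_lfracIntegral_le {a m c : ℝ} {F : ℝ → ENNReal} (hFm : Measurable F)
    (hF : ∫⁻ v in Ioi (0:ℝ), F v = 1) (ha : 0 < a) (ha1 : a ≤ 1) (ham : a ≤ m) (hc : 0 ≤ c)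
    (hsub : ∀ x, 0 < x → F x ≤ ENNReal.ofReal (c * x ^ (-m)) * lfracIntegral a F x)
    (n : ℕ) (b : ℝ) (hb : 0 < b) (hn : 1 ≤ b + n * a) :
    ∃ M : ℝ, 0 ≤ M ∧ ∀ x, 1 ≤ x → lfracIntegral b F x ≤ ENNReal.ofReal (M * x ^ (b - 1)) := by
  have base : ∀ b : ℝ, 1 ≤ b → ∃ M : ℝ, 0 ≤ M ∧ ∀ x, 1 ≤ x →
      lfracIntegral b F x ≤ ENNReal.ofReal (M * x ^ (b - 1)) := fun b h =>
    ⟨1, zero_le_one, fun x _ => by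
      rw [one_mul]; exact lfracIntegral_le_of_one_le h hF⟩
  induction n generalizing b with
  | zero => exact base b (by simpa using hn)
  | succ n ih =>
    rcases le_total 1 b with h1 | h1
    · exact base b h1
    obtain ⟨M, hM0, hM⟩ := ih (a + b) (by linarith) (by push_cast at hn; linarith)
    set C : ℝ := 2 ^ (1 - b) / a + 2 ^ (1 - a) / b
    have hC : 0 ≤ C := by positivity
    refine ⟨2 ^ (1 - b) + c * 2 ^ m * (C * M), by positivity, fun x hx => ?_⟩
    have hx0 : 0 < x := by linarith
    refine (lfracIntegral_le_add hFm hF ha ha1 hb h1 (ha.le.trans ham) hc hsub hx0).trans ?_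
    refine (add_le_add_right (mul_le_mul_right (mul_le_mul_right (hM x hx) _) _) _).trans ?_
    rw [← ENNReal.ofReal_mul hC, ← ENNReal.ofReal_mul (by positivity),
      ← ENNReal.ofReal_add (by positivity) (by positivity)]
    apply ENNReal.ofReal_le_ofReal
    have e1 : (x / 2) ^ (b - 1) = 2 ^ (1 - b) * x ^ (b - 1) := by
      rw [div_rpow hx0.le zero_le_two, div_eq_mul_inv, ← rpow_neg zero_le_two, neg_sub, mul_comm]
    have e2 : (x / 2) ^ (-m) = 2 ^ m * x ^ (-m) := by
      rw [div_rpow hx0.le zero_le_two, div_eq_mul_inv, ← rpow_neg zero_le_two, neg_neg, mul_comm]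
    have e3 : x ^ (-m) * x ^ (a + b - 1) ≤ x ^ (b - 1) := by
      rw [← rpow_add hx0]
      exact rpow_le_rpow_of_exponent_le hx (by linarith)
    rw [e1, e2, add_mul]
    have := mul_le_mul_of_nonneg_left e3 (show 0 ≤ c * 2 ^ m * (C * M) by positivity)
    linarith

theorem tendsto_setIntegral_one_sub_div_rpow_mul {a : ℝ} {f : ℝ → ℝ}
    (hf : IntegrableOn f (Ioi 0)) :
    Tendsto (fun x : ℝ => ∫ v in Ioc (0:ℝ) (x / 2), (1 - v / x) ^ (a - 1) * f v) atTop
      (nhds (∫ v in Ioi (0:ℝ), f v)) := by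
  have h1 : (fun x : ℝ => ∫ v in Ioc (0:ℝ) (x / 2), (1 - v / x) ^ (a - 1) * f v) =
      fun x => ∫ v in Ioi (0:ℝ), (Iic (x / 2)).indicator
        (fun v => (1 - v / x) ^ (a - 1) * f v) v := by
    ext x
    rw [integral_indicator measurableSet_Iic, Measure.restrict_restrict measurableSet_Iic,
      inter_comm, Ioi_inter_Iic]
  rw [h1]
  refine tendsto_integral_filter_of_dominated_convergence
    (fun v => max 1 ((1 / 2) ^ (a - 1)) * |f v|) ?_ ?_ (hf.abs.const_mul _) ?_
  · refine Eventually.of_forall fun x => ?_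
    refine AEStronglyMeasurable.indicator ?_ measurableSet_Iic
    exact ((Measurable.pow_const (by fun_prop) _).aestronglyMeasurable).mul hf.aestronglyMeasurable
  · filter_upwards [eventually_gt_atTop 0] with x hx
    filter_upwards [ae_restrict_mem measurableSet_Ioi] with v hv
    by_cases hvx : v ∈ Iic (x / 2)
    · have h2 : v / x ≤ 1 / 2 := by
        rw [div_le_iff₀ hx]
        linarith [mem_Iic.1 hvx]
      have h3 : 0 ≤ v / x := div_nonneg (mem_Ioi.1 hv).le hx.le
      have h4 : (1 - v / x) ^ (a - 1) ≤ max 1 ((1 / 2) ^ (a - 1)) := by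
        rcases le_total 1 a with h | h
        · exact le_max_of_le_left (rpow_le_one (by linarith) (by linarith) (by linarith))
        · exact le_max_of_le_right
            (rpow_le_rpow_of_nonpos (by norm_num) (by linarith) (by linarith))
      rw [indicator_of_mem hvx, norm_mul, norm_eq_abs, norm_eq_abs,
        abs_of_nonneg (rpow_nonneg (by linarith) _)]
      gcongr
    · rw [indicator_of_notMem hvx, norm_zero]
      positivity
  · refine Eventually.of_forall fun v => ?_
    have h2 : Tendsto (fun x : ℝ => (1 - v / x) ^ (a - 1) * f v) atTop (nhds (f v)) := by
      have h3 : Tendsto (fun x : ℝ => 1 - v / x) atTop (nhds 1) := by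
        simpa using (tendsto_const_nhds (x := (1:ℝ))).sub (tendsto_const_nhds.div_atTop tendsto_id)
      simpa using (h3.rpow_const (p := a - 1) (Or.inl one_ne_zero)).mul_const (f v)
    refine h2.congr' ?_
    filter_upwards [eventually_ge_atTop (2 * v)] with x hx
    rw [indicator_of_mem (show v ∈ Iic (x / 2) from by simp only [mem_Iic]; linarith)]

/-- Asymptotics at infinity: `f(x) ∼ x^{α−m−1}/Γ(α)` as `x → ∞`. -/
theorem density_solution_asymptotic_at_infty (α m : ℝ) (hα : 0 < α) (hm : α < m)
    (f : ℝ → ℝ) (hf : IsDensitySolution α m f) :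
    Filter.Tendsto (fun x : ℝ => Real.Gamma α * x ^ (m + 1 - α) * f x)
      Filter.atTop (nhds 1) := by
  obtain ⟨hfm, hf0, hf1, hfe⟩ := hf
  have hΓ : 0 < Real.Gamma α := Real.Gamma_pos_of_pos hα
  have hfi : IntegrableOn f (Ioi 0) := by
    by_contra h
    rw [integral_undef h] at hf1
    exact zero_ne_one hf1
  set F : ℝ → ENNReal := fun v => ENNReal.ofReal (f v)
  have hFm : Measurable F := by fun_prop
  have hF : ∫⁻ v in Ioi (0:ℝ), F v = 1 := by
    rw [← ofReal_integral_eq_lintegral_ofReal hfi, hf1, ENNReal.ofReal_one]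
    exact (ae_restrict_mem measurableSet_Ioi).mono hf0
  have hnn : ∀ x, ∀ v ∈ Ioo (0:ℝ) x, 0 ≤ (x - v) ^ (α - 1) * f v := fun x v hv =>
    mul_nonneg (rpow_nonneg (by linarith [hv.2]) _) (hf0 v hv.1)
  have hlf : ∀ x, lfracIntegral α F x =
      ∫⁻ v in Ioo (0:ℝ) x, ENNReal.ofReal ((x - v) ^ (α - 1) * f v) := fun x =>
    setLIntegral_congr_fun measurableSet_Ioo fun v hv =>
      (ENNReal.ofReal_mul (rpow_nonneg (by linarith [hv.2]) _)).symm
  have hfx : ∀ x, 0 < x → f x = 1 / Real.Gamma α * x ^ (-m) *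
      ∫ v in Ioo (0:ℝ) x, (x - v) ^ (α - 1) * f v := fun x hx => by
    have hp := rpow_pos_of_pos hx m
    have := hfe x hx
    rw [rpow_neg hx.le, mul_right_comm, ← this]
    field_simp
  have hsub : ∀ x, 0 < x →
      F x ≤ ENNReal.ofReal (1 / Real.Gamma α * x ^ (-m)) * lfracIntegral α F x := fun x hx => by
    simp only [F]
    rw [hfx x hx, ENNReal.ofReal_mul (by positivity), hlf]
    gcongr
    rw [integral_eq_lintegral_of_nonneg_ae
      ((ae_restrict_mem measurableSet_Ioo).mono (hnn x)) (by fun_prop)]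
    exact ENNReal.ofReal_toReal_le
  obtain ⟨M, hM0, hM⟩ : ∃ M : ℝ, 0 ≤ M ∧ ∀ x, 1 ≤ x →
      lfracIntegral α F x ≤ ENNReal.ofReal (M * x ^ (α - 1)) := by
    rcases le_total 1 α with h | h
    · exact ⟨1, zero_le_one, fun x _ => by
        rw [one_mul]; exact lfracIntegral_le_of_one_le h hF⟩
    · obtain ⟨n, hn⟩ := exists_nat_ge (1 / α)
      rw [div_le_iff₀ hα] at hn
      exact exists_lfracIntegral_le hFm hF hα h hm.le (by positivity) hsub n α hα (by linarith)
  have hint : ∀ x, 1 ≤ x → IntegrableOn (fun v => (x - v) ^ (α - 1) * f v) (Ioo 0 x) := by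
    intro x hx
    refine ⟨by fun_prop, ?_⟩
    rw [hasFiniteIntegral_iff_ofReal ((ae_restrict_mem measurableSet_Ioo).mono (hnn x)), ← hlf]
    exact (hM x hx).trans_lt ENNReal.ofReal_lt_top
  set D : ℝ := 1 / Real.Gamma α * M
  have hD : 0 ≤ D := by positivity
  have hbd : ∀ x, 1 ≤ x → f x ≤ D * x ^ (α - m - 1) := by
    intro x hx
    have hx0 : 0 < x := by linarith
    have h1 : F x ≤ ENNReal.ofReal (1 / Real.Gamma α * x ^ (-m) * (M * x ^ (α - 1))) := by
      rw [ENNReal.ofReal_mul (by positivity)]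
      exact (hsub x hx0).trans (mul_le_mul_right (hM x hx) _)
    have h2 := (ENNReal.ofReal_le_ofReal_iff (by positivity)).1 h1
    refine h2.trans (le_of_eq ?_)
    rw [show α - m - 1 = -m + (α - 1) by ring, rpow_add hx0]
    simp only [D]
    ring
  have hsplit : ∀ x, 1 ≤ x → Real.Gamma α * x ^ (m + 1 - α) * f x =
      (∫ v in Ioc (0:ℝ) (x / 2), (1 - v / x) ^ (α - 1) * f v) +
        x ^ (1 - α) * ∫ v in Ioo (x / 2) x, (x - v) ^ (α - 1) * f v := by
    intro x hx
    have hx0 : 0 < x := by linarith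
    have hu : Ioo 0 x = Ioc 0 (x / 2) ∪ Ioo (x / 2) x :=
      (Ioc_union_Ioo_eq_Ioo (by linarith) (by linarith)).symm
    have hi := hint x hx
    rw [hu] at hi
    have hd : Disjoint (Ioc 0 (x / 2)) (Ioo (x / 2) x) :=
      Set.disjoint_left.2 fun v h1 h2 => not_lt.2 h1.2 h2.1
    rw [hfx x hx0, hu, setIntegral_union hd measurableSet_Ioo hi.left_of_union hi.right_of_union]
    have e : ∀ I : ℝ, Real.Gamma α * x ^ (m + 1 - α) * (1 / Real.Gamma α * x ^ (-m) * I) =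
        x ^ (1 - α) * I := fun I => by
      rw [show 1 - α = (m + 1 - α) + (-m) by ring, rpow_add hx0]
      field_simp
    rw [e, mul_add, ← integral_const_mul]
    congr 1
    refine setIntegral_congr_fun measurableSet_Ioc fun v hv => ?_
    have : 1 - v / x = (x - v) / x := by field_simp
    rw [this, div_rpow (by linarith [hv.2]) hx0.le, div_eq_mul_inv, ← rpow_neg hx0.le, neg_sub]
    ring
  have htail : Tendsto (fun x : ℝ => x ^ (1 - α) *
      ∫ v in Ioo (x / 2) x, (x - v) ^ (α - 1) * f v) atTop (nhds 0) := by
    have hlim : Tendsto (fun x : ℝ => D * 2 ^ (m + 1 - α) / (2 ^ α * α) * x ^ (-(m - α))) atTop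
        (nhds 0) := by
      simpa using (tendsto_rpow_neg_atTop (sub_pos.2 hm)).const_mul
        (D * 2 ^ (m + 1 - α) / (2 ^ α * α))
    refine squeeze_zero' ?_ ?_ hlim
    · filter_upwards [eventually_ge_atTop 1] with x hx
      refine mul_nonneg (by positivity) (setIntegral_nonneg measurableSet_Ioo fun v hv => ?_)
      exact hnn x v ⟨by linarith [hv.1], hv.2⟩
    · filter_upwards [eventually_ge_atTop 2] with x hx
      have hx0 : 0 < x := by linarith
      have h1 : ∫ v in Ioo (x / 2) x, (x - v) ^ (α - 1) * f v ≤
          ∫ v in Ioo (x / 2) x, (x - v) ^ (α - 1) * (D * (x / 2) ^ (α - m - 1)) := by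
        refine setIntegral_mono_on ((hint x (by linarith)).mono_set
          (Ioo_subset_Ioo_left (by linarith)))
          ((integrableOn_sub_rpow hα (by linarith)).mul_const _) measurableSet_Ioo fun v hv => ?_
        refine mul_le_mul_of_nonneg_left ((hbd v (by linarith [hv.1])).trans ?_)
          (rpow_nonneg (by linarith [hv.2]) _)
        exact mul_le_mul_of_nonneg_left
          (rpow_le_rpow_of_nonpos (by linarith) hv.1.le (by linarith)) hD
      rw [integral_mul_const, integral_sub_rpow hα (by linarith), sub_half] at h1
      refine (mul_le_mul_of_nonneg_left h1 (by positivity)).trans (le_of_eq ?_)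
      rw [div_rpow hx0.le zero_le_two, div_rpow hx0.le zero_le_two,
        show -(m - α) = (1 - α) + α + (α - m - 1) by ring, rpow_add hx0, rpow_add hx0,
        show m + 1 - α = -(α - m - 1) by ring, rpow_neg zero_le_two]
      field_simp
  have hhead := tendsto_setIntegral_one_sub_div_rpow_mul (a := α) hfi
  rw [hf1] at hhead
  have h := hhead.add htail
  rw [add_zero] at h
  refine h.congr' ?_
  filter_upwards [eventually_ge_atTop 1] with x hx
  exact (hsplit x hx).symm
end
end
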